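/- Assume p ≥ 2. Let K̃ be a symmetric measurable kernel with Λ⁻¹|x−y|^{−(n+sp)} ≤ K̃(x,y) ≤ Λ|x−y|^{−(n+sp)} for x ≠ y, μ ∈ C_0^∞(ℝⁿ), let u ∈ W^{s,p}(ℝⁿ) be a weak solution of the kernel-K̃ fractional p-Laplace equation with datum μ in B_{2r}, and let v ∈ W^{s,p}(ℝⁿ) solve the homogeneous kernel-K̃ equation in B_r with v = u a.e. in ℝⁿ∖B_r; set w := u − v. Let γ ∈ [1, γ*), where γ* := n(p−1)/(n−ps) if p < n/s and γ* := ∞ if p ≥ n/s. Then ( ⨍_{B_r} |w|^γ dx )^{1/γ} ≤ c ( |μ|(B_r) / r^{n−sp} )^{1/(p−1)} for a constant c depending only on n, s, p, Λ, γ* − γ. -/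

import Mathlib

noncomputable section

open MeasureTheory Metric Set Filter Topology
open scoped ENNReal NNReal

/-- Euclidean space `ℝⁿ`. -/
abbrev Rn (n : ℕ) : Type := EuclideanSpace ℝ (Fin n)

/-- `q_* = max {1, p-1}`. -/
def qStar (p : ℝ) : ℝ := max 1 (p - 1)

/-- `q̄ = min {n(p-1)/(n-s), p}`. -/
def qBar (n : ℕ) (s p : ℝ) : ℝ := min ((n : ℝ) * (p - 1) / ((n : ℝ) - s)) p

/-- Gagliardo seminorm raised to the power `p`, as an `ℝ≥0∞`-valued double integral. -/
def gagliardo (n : ℕ) (s p : ℝ) (O : Set (Rn n)) (v : Rn n → ℝ) : ℝ≥0∞ :=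
  ∫⁻ x in O, ∫⁻ y in O, ENNReal.ofReal (|v x - v y| ^ p / ‖x - y‖ ^ ((n : ℝ) + s * p))

/-- `v ∈ W^{s,p}(O)`. -/
def memWsp (n : ℕ) (s p : ℝ) (O : Set (Rn n)) (v : Rn n → ℝ) : Prop :=
  AEMeasurable v (volume.restrict O) ∧
    (∫⁻ x in O, ENNReal.ofReal (|v x| ^ p)) < ⊤ ∧ gagliardo n s p O v < ⊤

/-- `Tail(v; x₀, r)`. -/
def tailFn (n : ℕ) (s p : ℝ) (v : Rn n → ℝ) (x₀ : Rn n) (r : ℝ) : ℝ≥0∞ :=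
  (ENNReal.ofReal (r ^ (s * p)) *
      ∫⁻ x in (ball x₀ r)ᶜ,
        ENNReal.ofReal (|v x| ^ (p - 1) / ‖x - x₀‖ ^ ((n : ℝ) + s * p))) ^ (1 / (p - 1))

/-- `v ∈ L^{p-1}_{sp}(ℝⁿ)`. -/
def memTailSpace (n : ℕ) (s p : ℝ) (v : Rn n → ℝ) : Prop :=
  AEMeasurable v (volume : Measure (Rn n)) ∧
    (∀ R : ℝ, (∫⁻ x in ball (0 : Rn n) R, ENNReal.ofReal (|v x| ^ (p - 1))) < ⊤) ∧
    ∀ z : Rn n, ∀ r : ℝ, 0 < r → tailFn n s p v z r < ⊤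

/-- `φ ∈ C_0^∞(O)`. -/
def IsTestFun (n : ℕ) (O : Set (Rn n)) (φ : Rn n → ℝ) : Prop :=
  ContDiff ℝ (⊤ : ℕ∞) φ ∧ HasCompactSupport φ ∧ tsupport φ ⊆ O

/-- The nonlocal form `⟨-L_Φ u, φ⟩`. -/
def nonlocalForm (n : ℕ) (Φ : ℝ → ℝ) (K : Rn n → Rn n → ℝ) (u φ : Rn n → ℝ) : ℝ :=
  ∫ x : Rn n, ∫ y : Rn n, Φ (u x - u y) * (φ x - φ y) * K x y

/-- Ellipticity/coercivity bounds on the kernel `K`. -/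
def KernelBounds (n : ℕ) (Λ s p : ℝ) (K : Rn n → Rn n → ℝ) : Prop :=
  Measurable (Function.uncurry K) ∧
    ∀ x y : Rn n, x ≠ y →
      1 / (Λ * ‖x - y‖ ^ ((n : ℝ) + s * p)) ≤ K x y ∧
        K x y ≤ Λ / ‖x - y‖ ^ ((n : ℝ) + s * p)

/-- Structure conditions on `Φ`. -/
def PhiBounds (Λ p : ℝ) (Φ : ℝ → ℝ) : Prop :=
  Continuous Φ ∧ Φ 0 = 0 ∧
    ∀ t : ℝ, |t| ^ p / Λ ≤ Φ t * t ∧ Φ t * t ≤ Λ * |t| ^ p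

/-- `∫ φ dμ` for a signed measure `μ`. -/
def sintegral (n : ℕ) (μ : MeasureTheory.SignedMeasure (Rn n)) (φ : Rn n → ℝ) : ℝ :=
  (∫ x, φ x ∂μ.toJordanDecomposition.posPart) -
    ∫ x, φ x ∂μ.toJordanDecomposition.negPart

/-- Weak (energy) solution of `-L_Φ u = f` in `Ω`, `u = g` on `ℝⁿ ∖ Ω`. -/
def WeakSol (n : ℕ) (Φ : ℝ → ℝ) (K : Rn n → Rn n → ℝ) (s p : ℝ)
    (Ω : Set (Rn n)) (f g u : Rn n → ℝ) : Prop :=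
  memWsp n s p univ u ∧ (∀ᵐ x : Rn n, x ∉ Ω → u x = g x) ∧
    ∀ φ : Rn n → ℝ, IsTestFun n Ω φ → nonlocalForm n Φ K u φ = ∫ x : Rn n, φ x * f x

/-- Weak subsolution of the homogeneous equation `-L_Φ w = 0` in `Ω`. -/
def WeakSubSol (n : ℕ) (Φ : ℝ → ℝ) (K : Rn n → Rn n → ℝ) (s p : ℝ)
    (Ω : Set (Rn n)) (w : Rn n → ℝ) : Prop :=
  memWsp n s p univ w ∧
    ∀ φ : Rn n → ℝ, IsTestFun n Ω φ → (∀ x, 0 ≤ φ x) → nonlocalForm n Φ K w φ ≤ 0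

/-- The approximation properties required of a SOLA. -/
def SOLAApprox (n : ℕ) (Φ : ℝ → ℝ) (K : Rn n → Rn n → ℝ) (s p : ℝ)
    (Ω : Set (Rn n)) (μ : MeasureTheory.SignedMeasure (Rn n)) (g u : Rn n → ℝ)
    (uj μj gj : ℕ → Rn n → ℝ) : Prop :=
  (∀ j, ContDiff ℝ (⊤ : ℕ∞) (μj j) ∧ HasCompactSupport (μj j)) ∧
  (∀ j, ContDiff ℝ (⊤ : ℕ∞) (gj j) ∧ HasCompactSupport (gj j)) ∧
  (∀ j, WeakSol n Φ K s p Ω (μj j) (gj j) (uj j)) ∧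
  (∀ᵐ x : Rn n, Tendsto (fun j => uj j x) atTop (𝓝 (u x))) ∧
  (∀ q : ℝ, qStar p ≤ q → q < qBar n s p → ∀ z : Rn n, ∀ r : ℝ, 0 < r →
    Tendsto (fun j => ∫⁻ x in ball z r, ENNReal.ofReal (|uj j x - u x| ^ q)) atTop (𝓝 0)) ∧
  (∀ φ : Rn n → ℝ, Continuous φ → HasCompactSupport φ → tsupport φ ⊆ Ω →
    Tendsto (fun j => ∫ x : Rn n, φ x * μj j x) atTop (𝓝 (sintegral n μ φ))) ∧
  (∀ z : Rn n, ∀ r : ℝ, 0 < r →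
    Filter.limsup (fun j => ∫⁻ x in ball z r, ENNReal.ofReal |μj j x|) atTop
      ≤ μ.totalVariation (closedBall z r)) ∧
  (∀ z : Rn n, ∀ r : ℝ, 0 < r →
    Tendsto (fun j =>
        (∫⁻ x in ball z r, ENNReal.ofReal (|gj j x - g x| ^ p)) +
          gagliardo n s p (ball z r) (fun x => gj j x - g x)) atTop (𝓝 0) ∧
      Tendsto (fun j => tailFn n s p (fun x => gj j x - g x) z r) atTop (𝓝 0))

/-- SOLA of the Dirichlet problem `-L_Φ u = μ` in `Ω`, `u = g` on `ℝⁿ ∖ Ω`. -/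
def IsSOLA (n : ℕ) (Φ : ℝ → ℝ) (K : Rn n → Rn n → ℝ) (s p : ℝ)
    (Ω : Set (Rn n)) (μ : MeasureTheory.SignedMeasure (Rn n)) (g u : Rn n → ℝ) : Prop :=
  (∀ h q : ℝ, 0 < h → h < s → qStar p ≤ q → q < qBar n s p → memWsp n h q Ω u) ∧
  (∀ φ : Rn n → ℝ, IsTestFun n Ω φ → nonlocalForm n Φ K u φ = sintegral n μ φ) ∧
  (∀ᵐ x : Rn n, x ∉ Ω → u x = g x) ∧
  ∃ uj μj gj : ℕ → Rn n → ℝ, SOLAApprox n Φ K s p Ω μ g u uj μj gj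

/-- Truncated Wolff potential `W^ν_{s,p}(x₀, r)`. -/
def wolff (n : ℕ) (s p : ℝ) (ν : Measure (Rn n)) (x₀ : Rn n) (r : ℝ) : ℝ≥0∞ :=
  ∫⁻ ρ in Ioc (0 : ℝ) r,
    (ν (ball x₀ ρ) / ENNReal.ofReal (ρ ^ ((n : ℝ) - s * p))) ^ (1 / (p - 1)) /
      ENNReal.ofReal ρ

/-- Integral average of `u` over `B_r(x₀)`. -/
def ballAvg (n : ℕ) (u : Rn n → ℝ) (x₀ : Rn n) (r : ℝ) : ℝ :=
  ⨍ x in ball x₀ r, u x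

/-- Local excess `A(f; x₀, r)`. -/
def locExcess (n : ℕ) (p : ℝ) (f : Rn n → ℝ) (x₀ : Rn n) (r : ℝ) : ℝ≥0∞ :=
  ((volume (ball x₀ r))⁻¹ *
      ∫⁻ x in ball x₀ r, ENNReal.ofReal (|f x - ballAvg n f x₀ r| ^ qStar p)) ^ (1 / qStar p)

/-- Global excess `E(f; x₀, r)`. -/
def excess (n : ℕ) (s p : ℝ) (f : Rn n → ℝ) (x₀ : Rn n) (r : ℝ) : ℝ≥0∞ :=
  locExcess n p f x₀ r + tailFn n s p (fun x => f x - ballAvg n f x₀ r) x₀ r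

/-- `g ∈ W^{s,p}_loc(ℝⁿ) ∩ L^{p-1}_{sp}(ℝⁿ)`. -/
def BoundaryDatum (n : ℕ) (s p : ℝ) (g : Rn n → ℝ) : Prop :=
  (∀ z : Rn n, ∀ r : ℝ, 0 < r → memWsp n s p (ball z r) g) ∧ memTailSpace n s p g

/-- Symmetric measurable kernel with ellipticity bounds. -/
def SymKernel (n : ℕ) (Λ s p : ℝ) (Kt : Rn n → Rn n → ℝ) : Prop :=
  KernelBounds n Λ s p Kt ∧ ∀ x y : Rn n, Kt x y = Kt y x

/-- Weak solution of the kernel-`Kt` fractional `p`-Laplace equation with datum `f` in `O`. -/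
def WeakSolP (n : ℕ) (Kt : Rn n → Rn n → ℝ) (s p : ℝ) (O : Set (Rn n))
    (f u : Rn n → ℝ) : Prop :=
  memWsp n s p univ u ∧
    ∀ φ : Rn n → ℝ, IsTestFun n O φ →
      (∫ x : Rn n, ∫ y : Rn n,
          |u x - u y| ^ (p - 2) * (u x - u y) * (φ x - φ y) * Kt x y) =
        ∫ x : Rn n, φ x * f x

theorem eLpNorm_comp_smul_add {E : Type*} [NormedAddCommGroup E] [NormedSpace ℝ E]
    [FiniteDimensional ℝ E] [MeasurableSpace E] [BorelSpace E] (ν : Measure E)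
    [ν.IsAddHaarMeasure] {p : ℝ≥0∞} (hp : p ≠ ∞) {f : E → ℝ} (hf : AEStronglyMeasurable f ν)
    {a : ℝ} (ha : a ≠ 0) (b : E) :
    eLpNorm (fun X => f (a • X + b)) p ν =
      ENNReal.ofReal |(a ^ Module.finrank ℝ E)⁻¹| ^ (1 / p).toReal * eLpNorm f p ν := by
  have h1 : AEStronglyMeasurable (fun X => f (X + b)) ν :=
    hf.comp_measurePreserving (measurePreserving_add_right ν b)
  have h2 := eLpNorm_comp_measurePreserving (p := p) hf (measurePreserving_add_right ν b)
  rw [← h2, ← smul_eq_mul, ← eLpNorm_smul_measure_of_ne_top hp, ← Measure.map_addHaar_smul ν ha,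
    eLpNorm_map_measure]
  · rfl
  · rw [Measure.map_addHaar_smul ν ha]
    exact h1.smul_measure _
  · fun_prop

theorem tendsto_eLpNorm_affine_sub_of_continuous {E : Type*} [NormedAddCommGroup E]
    [NormedSpace ℝ E]
    [FiniteDimensional ℝ E] [MeasurableSpace E] [BorelSpace E] (ν : Measure E)
    [ν.IsAddHaarMeasure] {p : ℝ≥0∞} (hp1 : 1 ≤ p) (hp : p ≠ ∞) {g : E → ℝ}
    (hg : Continuous g) (hc : HasCompactSupport g) :
    Tendsto (fun q : ℝ × ℝ × E => eLpNorm (fun X => q.1 * g (q.2.1 • X + q.2.2) - g X) p ν)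
      (𝓝 (1, 1, 0)) (𝓝 0) := by
  have hp0 : p ≠ 0 := by rintro rfl; simp at hp1
  have hpr : 0 < p.toReal := ENNReal.toReal_pos hp0 hp
  obtain ⟨B, hB⟩ := hc.exists_bound_of_continuous hg
  have hB0 : 0 ≤ B := (norm_nonneg _).trans (hB 0)
  obtain ⟨R, hR⟩ := hc.isCompact.isBounded.subset_closedBall (0 : E)
  have hz : ∀ x : E, R < ‖x‖ → g x = 0 := by
    intro x hx
    by_contra h
    have := hR (subset_tsupport _ h)
    simp at this; linarith
  have hev : ∀ᶠ q : ℝ × ℝ × E in 𝓝 (1, 1, 0), |q.1| ≤ 2 ∧ 1 / 2 ≤ q.2.1 ∧ ‖q.2.2‖ ≤ 1 := by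
    refine Filter.Eventually.and ?_ (Filter.Eventually.and ?_ ?_)
    · have : Tendsto (fun q : ℝ × ℝ × E => |q.1|) (𝓝 (1, 1, 0)) (𝓝 |1|) :=
        (Continuous.tendsto (by fun_prop) _)
      exact this.eventually_le_const (by norm_num)
    · have : Tendsto (fun q : ℝ × ℝ × E => q.2.1) (𝓝 (1, 1, 0)) (𝓝 1) :=
        (Continuous.tendsto (by fun_prop) _)
      exact this.eventually_const_le (by norm_num)
    · have : Tendsto (fun q : ℝ × ℝ × E => ‖q.2.2‖) (𝓝 (1, 1, 0)) (𝓝 ‖(0:E)‖) :=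
        (Continuous.tendsto (f := fun q : ℝ × ℝ × E => ‖q.2.2‖) (by fun_prop) (1, 1, 0))
      exact this.eventually_le_const (by simp)
  have key : Tendsto (fun q : ℝ × ℝ × E =>
      ∫⁻ X, ‖q.1 * g (q.2.1 • X + q.2.2) - g X‖ₑ ^ p.toReal ∂ν) (𝓝 (1, 1, 0))
      (𝓝 (∫⁻ _, 0 ∂ν)) := by
    refine tendsto_lintegral_filter_of_dominated_convergence
      ((closedBall (0 : E) (2 * (|R| + 1))).indicator
        (fun _ => ENNReal.ofReal (3 * B) ^ p.toReal)) ?_ ?_ ?_ ?_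
    · refine Eventually.of_forall fun q => ?_
      have : Continuous fun X => q.1 * g (q.2.1 • X + q.2.2) - g X := by fun_prop
      exact (this.measurable.enorm).pow_const _
    · filter_upwards [hev] with q hq
      refine Eventually.of_forall fun X => ?_
      by_cases hX : X ∈ closedBall (0 : E) (2 * (|R| + 1))
      · rw [indicator_of_mem hX]
        refine ENNReal.rpow_le_rpow ?_ hpr.le
        rw [← ofReal_norm]
        refine ENNReal.ofReal_le_ofReal ?_
        have h1 := hB (q.2.1 • X + q.2.2)
        have h2 := hB X
        calc ‖q.1 * g (q.2.1 • X + q.2.2) - g X‖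
            ≤ ‖q.1 * g (q.2.1 • X + q.2.2)‖ + ‖g X‖ := norm_sub_le _ _
          _ ≤ 2 * B + B := by
            rw [norm_mul]
            gcongr
            exact hq.1
          _ = 3 * B := by ring
      · rw [indicator_of_notMem hX]
        simp only [mem_closedBall, dist_zero_right, not_le] at hX
        have hRR := le_abs_self R
        have hR0 := abs_nonneg R
        have h1 : g X = 0 := hz _ (by linarith)
        have h2 : g (q.2.1 • X + q.2.2) = 0 := by
          apply hz
          have h3 : ‖q.2.1 • X‖ - ‖q.2.2‖ ≤ ‖q.2.1 • X + q.2.2‖ := by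
            have := norm_sub_norm_le (q.2.1 • X) (-q.2.2)
            rwa [norm_neg, sub_neg_eq_add] at this
          rw [norm_smul, Real.norm_eq_abs, abs_of_nonneg (by linarith [hq.2.1])] at h3
          have h4 : 1 / 2 * ‖X‖ ≤ q.2.1 * ‖X‖ := by gcongr; exact hq.2.1
          linarith [hq.2.2]
        simp [h1, h2, hpr]
    · rw [lintegral_indicator measurableSet_closedBall, lintegral_const]
      refine ENNReal.mul_ne_top (ENNReal.rpow_ne_top_of_nonneg hpr.le ENNReal.ofReal_ne_top) ?_
      simpa using (measure_closedBall_lt_top (μ := ν)).ne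
    · refine Eventually.of_forall fun X => ?_
      have : Continuous fun q : ℝ × ℝ × E => ‖q.1 * g (q.2.1 • X + q.2.2) - g X‖ₑ ^ p.toReal := by
        have h : Continuous fun q : ℝ × ℝ × E => q.1 * g (q.2.1 • X + q.2.2) - g X := by fun_prop
        exact (ENNReal.continuous_rpow_const).comp h.enorm
      have := this.tendsto (1, 1, 0)
      simpa [hpr] using this
  have h3 := (ENNReal.continuous_rpow_const (y := 1 / p.toReal)).tendsto 0
  simp only [lintegral_zero] at key
  have h4 := h3.comp key
  rw [ENNReal.zero_rpow_of_pos (by positivity)] at h4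
  refine h4.congr fun q => ?_
  rw [eLpNorm_eq_lintegral_rpow_enorm_toReal hp0 hp]
  rfl

/-- Continuity in `L^p` of the action of affine maps `X ↦ a X + b` at the identity. -/
theorem tendsto_eLpNorm_affine_sub {E : Type*} [NormedAddCommGroup E] [NormedSpace ℝ E]
    [FiniteDimensional ℝ E] [MeasurableSpace E] [BorelSpace E] (ν : Measure E)
    [ν.IsAddHaarMeasure] {p : ℝ≥0∞} (hp1 : 1 ≤ p) (hp : p ≠ ∞) {U : E → ℝ}
    (hU : MemLp U p ν) :
    Tendsto (fun q : ℝ × ℝ × E => eLpNorm (fun X => q.1 * U (q.2.1 • X + q.2.2) - U X) p ν)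
      (𝓝 (1, 1, 0)) (𝓝 0) := by
  rw [ENNReal.tendsto_nhds_zero]
  intro ε hε
  have hfac : Tendsto (fun q : ℝ × ℝ × E => ENNReal.ofReal |q.1| *
      ENNReal.ofReal |(q.2.1 ^ Module.finrank ℝ E)⁻¹| ^ (1 / p).toReal) (𝓝 (1, 1, 0))
      (𝓝 (ENNReal.ofReal |1| *
      ENNReal.ofReal |((1:ℝ) ^ Module.finrank ℝ E)⁻¹| ^ (1 / p).toReal)) := by
    have h2 : Tendsto (fun q : ℝ × ℝ × E => q.2.1) (𝓝 (1, 1, 0)) (𝓝 1) :=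
        (Continuous.tendsto (by fun_prop) _)
    have h1 : Tendsto (fun q : ℝ × ℝ × E => q.1) (𝓝 (1, 1, 0)) (𝓝 1) :=
        (Continuous.tendsto (by fun_prop) _)
    refine ENNReal.Tendsto.mul (ENNReal.tendsto_ofReal h1.abs) (by simp) ?_ (by simp)
    refine (ENNReal.continuous_rpow_const.tendsto _).comp (ENNReal.tendsto_ofReal ?_)
    exact ((h2.pow _).inv₀ (by simp)).abs
  simp only [abs_one, ENNReal.ofReal_one, one_pow, inv_one, ENNReal.one_rpow, mul_one] at hfac
  have hfac2 := hfac.eventually_le_const (by norm_num : (1 : ℝ≥0∞) < 2)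
  have hne : ∀ᶠ q : ℝ × ℝ × E in 𝓝 (1, 1, 0), q.2.1 ≠ 0 := by
    have h2 : Tendsto (fun q : ℝ × ℝ × E => q.2.1) (𝓝 (1, 1, 0)) (𝓝 1) :=
        (Continuous.tendsto (by fun_prop) _)
    exact h2.eventually_ne one_ne_zero
  have hε4 : ε / 4 ≠ 0 := by simp [hε.ne']
  obtain ⟨g, hgc, hgU, hgcont, hgLp⟩ := hU.exists_hasCompactSupport_eLpNorm_sub_le hp hε4
  have hg := tendsto_eLpNorm_affine_sub_of_continuous ν hp1 hp hgcont hgc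
  rw [ENNReal.tendsto_nhds_zero] at hg
  filter_upwards [hg (ε / 4) (pos_iff_ne_zero.2 hε4), hfac2, hne] with q h1 h2 h3
  have hD : AEStronglyMeasurable (U - g) ν := hU.1.sub hgLp.1
  have e1 : eLpNorm (fun X => q.1 * (U - g) (q.2.1 • X + q.2.2)) p ν ≤ 2 * (ε / 4) := by
    have : (fun X => q.1 * (U - g) (q.2.1 • X + q.2.2)) =
        q.1 • (fun X => (U - g) (q.2.1 • X + q.2.2)) := rfl
    rw [this, eLpNorm_const_smul, eLpNorm_comp_smul_add ν hp hD h3, ← mul_assoc,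
      ← ofReal_norm, Real.norm_eq_abs]
    gcongr
  have hqmp : Measure.QuasiMeasurePreserving (fun X : E => q.2.1 • X + q.2.2) ν ν := by
    have hA : Measure.QuasiMeasurePreserving (fun X : E => q.2.1 • X) ν ν :=
      ⟨by fun_prop, by
        rw [Measure.map_addHaar_smul ν h3]; exact Measure.smul_absolutelyContinuous⟩
    exact (measurePreserving_add_right ν q.2.2).quasiMeasurePreserving.comp hA
  have m1 : AEStronglyMeasurable (fun X => q.1 * (U - g) (q.2.1 • X + q.2.2)) ν :=
    (hD.comp_quasiMeasurePreserving hqmp).const_mul q.1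
  have m2 : AEStronglyMeasurable (fun X => q.1 * g (q.2.1 • X + q.2.2) - g X) ν := by
    have : Continuous fun X => q.1 * g (q.2.1 • X + q.2.2) - g X := by fun_prop
    exact this.aestronglyMeasurable
  have hsplit : (fun X => q.1 * U (q.2.1 • X + q.2.2) - U X) =
      ((fun X => q.1 * (U - g) (q.2.1 • X + q.2.2)) +
        (fun X => q.1 * g (q.2.1 • X + q.2.2) - g X)) - (U - g) := by
    ext X; simp; ring
  rw [hsplit]
  calc _ ≤ eLpNorm (fun X => q.1 * (U - g) (q.2.1 • X + q.2.2)) p ν +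
        eLpNorm (fun X => q.1 * g (q.2.1 • X + q.2.2) - g X) p ν + eLpNorm (U - g) p ν :=
        (eLpNorm_sub_le (m1.add m2) hD hp1).trans (by gcongr; exact eLpNorm_add_le m1 m2 hp1)
    _ ≤ 2 * (ε / 4) + ε / 4 + ε / 4 := by gcongr
    _ = 4 * (ε / 4) := by ring
    _ = ε := by
      rw [ENNReal.mul_div_cancel (by norm_num) (by norm_num)]

/-- The difference quotient `(v x - v y) / |x - y| ^ (n / p + s)` on `ℝⁿ × ℝⁿ`. -/
def diffQuot (n : ℕ) (s p : ℝ) (v : Rn n → ℝ) (X : Rn n × Rn n) : ℝ :=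
  (v X.1 - v X.2) / ‖X.1 - X.2‖ ^ ((n : ℝ) / p + s)

theorem measurable_diffQuot {n : ℕ} (s p : ℝ) {v : Rn n → ℝ} (hv : Measurable v) :
    Measurable (diffQuot n s p v) := by
  unfold diffQuot
  fun_prop

theorem enorm_diffQuot_rpow {n : ℕ} {s p : ℝ} (hp : 0 < p) (v : Rn n → ℝ) (X : Rn n × Rn n) :
    ‖diffQuot n s p v X‖ₑ ^ p =
      ENNReal.ofReal (|v X.1 - v X.2| ^ p / ‖X.1 - X.2‖ ^ ((n : ℝ) + s * p)) := by
  rw [← ofReal_norm, ENNReal.ofReal_rpow_of_nonneg (norm_nonneg _) hp.le, diffQuot, norm_div,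
    Real.div_rpow (norm_nonneg _) (norm_nonneg _), Real.norm_eq_abs,
    Real.norm_of_nonneg (by positivity), ← Real.rpow_mul (norm_nonneg _)]
  congr 4
  field_simp

theorem gagliardo_univ_eq {n : ℕ} {s p : ℝ} (hp : 0 < p) {v : Rn n → ℝ} (hv : Measurable v) :
    gagliardo n s p univ v = ∫⁻ X : Rn n × Rn n, ‖diffQuot n s p v X‖ₑ ^ p := by
  have : Measurable fun X => ‖diffQuot n s p v X‖ₑ ^ p :=
    (measurable_diffQuot s p hv).enorm.pow_const _
  rw [Measure.volume_eq_prod, lintegral_prod _ this.aemeasurable]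
  simp only [gagliardo, Measure.restrict_univ, enorm_diffQuot_rpow hp]

theorem memLp_diffQuot {n : ℕ} {s p : ℝ} (hp : 0 < p) {v : Rn n → ℝ} (hv : Measurable v)
    (hg : gagliardo n s p univ v < ⊤) : MemLp (diffQuot n s p v) (ENNReal.ofReal p) := by
  refine ⟨(measurable_diffQuot s p hv).aestronglyMeasurable, ?_⟩
  rw [eLpNorm_lt_top_iff_lintegral_rpow_enorm_lt_top (by simpa using hp) ENNReal.ofReal_ne_top,
    ENNReal.toReal_ofReal hp.le, ← gagliardo_univ_eq hp hv]
  exact hg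

theorem diffQuot_comp_affine {n : ℕ} (s p : ℝ) (v : Rn n → ℝ) {a : ℝ} (ha : 0 < a) (b : Rn n)
    (X : Rn n × Rn n) :
    (v (a • X.1 + b) - v (a • X.2 + b)) / ‖X.1 - X.2‖ ^ ((n : ℝ) / p + s) =
      a ^ ((n : ℝ) / p + s) * diffQuot n s p v (a • X + (b, b)) := by
  have h1 : ‖a • X.1 + b - (a • X.2 + b)‖ = a * ‖X.1 - X.2‖ := by
    rw [add_sub_add_right_eq_sub, ← smul_sub, norm_smul, Real.norm_of_nonneg ha.le]
  simp only [diffQuot, Prod.fst_add, Prod.smul_fst, Prod.snd_add, Prod.smul_snd, h1]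
  rw [Real.mul_rpow ha.le (norm_nonneg _), mul_div_assoc', mul_div_mul_left]
  exact (Real.rpow_pos_of_pos ha _).ne'

theorem enorm_integral_rpow_le {α : Type*} [MeasurableSpace α] (π : Measure α)
    [IsProbabilityMeasure π] {p : ℝ} (hp : 1 ≤ p) {f : α → ℝ} (hf : Measurable f) :
    ‖∫ z, f z ∂π‖ₑ ^ p ≤ ∫⁻ z, ‖f z‖ₑ ^ p ∂π := by
  have hp0 : 0 < p := by linarith
  have h1 := eLpNorm'_le_eLpNorm'_of_exponent_le one_pos hp π hf.aestronglyMeasurable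
  simp only [eLpNorm', ENNReal.rpow_one, div_one] at h1
  calc ‖∫ z, f z ∂π‖ₑ ^ p ≤ (∫⁻ z, ‖f z‖ₑ ∂π) ^ p := by
        gcongr; exact enorm_integral_le_lintegral_enorm _
    _ ≤ ((∫⁻ z, ‖f z‖ₑ ^ p ∂π) ^ (1 / p)) ^ p := by gcongr
    _ = _ := by rw [← ENNReal.rpow_mul, one_div, inv_mul_cancel₀ hp0.ne', ENNReal.rpow_one]

theorem lintegral_enorm_integral_rpow_le {α β : Type*} [MeasurableSpace α] [MeasurableSpace β]
    (π : Measure α) [IsProbabilityMeasure π] {ν : Measure β} [SFinite ν] {p : ℝ} (hp : 1 ≤ p)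
    {f : β → α → ℝ} (hf : Measurable (Function.uncurry f)) {ε : ℝ≥0∞}
    (hε : ∀ᵐ z ∂π, ∫⁻ X, ‖f X z‖ₑ ^ p ∂ν ≤ ε) :
    ∫⁻ X, ‖∫ z, f X z ∂π‖ₑ ^ p ∂ν ≤ ε :=
  calc ∫⁻ X, ‖∫ z, f X z ∂π‖ₑ ^ p ∂ν ≤ ∫⁻ X, (∫⁻ z, ‖f X z‖ₑ ^ p ∂π) ∂ν :=
        lintegral_mono fun X => enorm_integral_rpow_le π hp (hf.comp measurable_prodMk_left)
    _ = ∫⁻ z, (∫⁻ X, ‖f X z‖ₑ ^ p ∂ν) ∂π :=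
        lintegral_lintegral_swap ((hf.enorm.pow_const p).aemeasurable)
    _ ≤ ∫⁻ _, ε ∂π := lintegral_mono_ae hε
    _ = ε := by simp

/-- Bounded functions of finite Gagliardo energy vanishing outside a ball are approximated in
energy by equally bounded test functions. -/
theorem exists_testFun_gagliardo_sub_le {n : ℕ} {s p : ℝ} (hp : 1 ≤ p)
    {φ : Rn n → ℝ} (hm : Measurable φ) {k : ℝ} (hk : ∀ x, |φ x| ≤ k) {x₀ : Rn n} {r : ℝ}
    (hr : 0 < r) (h0 : ∀ x, x ∉ ball x₀ r → φ x = 0) (hg : gagliardo n s p univ φ < ⊤)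
    {ε : ℝ≥0∞} (hε : ε ≠ 0) :
    ∃ ψ : Rn n → ℝ, IsTestFun n (ball x₀ r) ψ ∧ (∀ x, |ψ x| ≤ k) ∧
      gagliardo n s p univ (fun x => ψ x - φ x) ≤ ε := by
  have hp0 : 0 < p := by linarith
  set κ : ℝ := (n : ℝ) / p + s with hκ
  set U := diffQuot n s p φ with hU
  have hUm : Measurable U := measurable_diffQuot s p hm
  have : (volume : Measure (Rn n × Rn n)).IsAddHaarMeasure :=
    inferInstanceAs ((volume : Measure (Rn n)).prod volume).IsAddHaarMeasure
  have hlim := tendsto_eLpNorm_affine_sub (volume : Measure (Rn n × Rn n))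
    (p := ENNReal.ofReal p) (by simpa using hp) ENNReal.ofReal_ne_top (memLp_diffQuot hp0 hm hg)
  have hpar : Tendsto (fun q : ℝ × Rn n => ((q.1 ^ κ, q.1,
      ((1 - q.1) • x₀ - q.2, (1 - q.1) • x₀ - q.2)) : ℝ × ℝ × (Rn n × Rn n)))
      (𝓝 (1, 0)) (𝓝 (1, 1, 0)) := by
    have hb : Tendsto (fun q : ℝ × Rn n => (1 - q.1) • x₀ - q.2) (𝓝 (1, 0)) (𝓝 0) := by
      have : Continuous fun q : ℝ × Rn n => (1 - q.1) • x₀ - q.2 := by fun_prop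
      simpa using this.tendsto (1, 0)
    have ha : Tendsto (fun q : ℝ × Rn n => q.1) (𝓝 (1, 0)) (𝓝 1) :=
      continuous_fst.tendsto _
    have hc : Tendsto (fun q : ℝ × Rn n => q.1 ^ κ) (𝓝 (1, 0)) (𝓝 1) := by
      simpa using ha.rpow_const (p := κ) (Or.inl one_ne_zero)
    exact hc.prodMk_nhds (ha.prodMk_nhds (hb.prodMk_nhds hb))
  have hε1 : 0 < ε ^ (1 / p) := ENNReal.rpow_pos_of_nonneg (pos_iff_ne_zero.2 hε) (by positivity)
  have hev := (hlim.comp hpar).eventually_le_const hε1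
  obtain ⟨δ, hδ, hball⟩ := Metric.eventually_nhds_iff.1 hev
  set a : ℝ := 1 + δ / 2 with ha
  have ha0 : 0 < a := by positivity
  set ε' : ℝ := min (δ / 2) (δ / 4 * r) with hε'
  have hε'0 : 0 < ε' := by positivity
  have hsmall : ∀ z : Rn n, ‖z‖ < ε' → ∫⁻ X : Rn n × Rn n, ‖a ^ κ * U (a • X +
      ((1 - a) • x₀ - z, (1 - a) • x₀ - z)) - U X‖ₑ ^ p ≤ ε := by
    intro z hz
    have hd : dist (a, z) ((1 : ℝ), (0 : Rn n)) < δ := by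
      rw [Prod.dist_eq, max_lt_iff]
      constructor
      · simp only [ha, Real.dist_eq, add_sub_cancel_left]
        rw [abs_of_pos (by positivity)]; linarith
      · simp only [dist_zero_right]
        have := min_le_left (δ / 2) (δ / 4 * r)
        linarith
    have h1 := hball hd
    simp only [Function.comp] at h1
    rw [eLpNorm_eq_lintegral_rpow_enorm_toReal (by simpa using hp0) ENNReal.ofReal_ne_top,
      ENNReal.toReal_ofReal hp0.le] at h1
    exact (ENNReal.rpow_le_rpow_iff (by positivity)).1 h1
  let η : ContDiffBump (0 : Rn n) := ⟨ε' / 2, ε', by positivity, by linarith⟩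
  have hηm : Measurable (η.normed volume) := η.continuous_normed.measurable
  let π : Measure (Rn n) := volume.withDensity fun z => ENNReal.ofReal (η.normed volume z)
  have hπ : IsProbabilityMeasure π := by
    refine ⟨?_⟩
    rw [withDensity_apply _ MeasurableSet.univ, Measure.restrict_univ,
      ← ofReal_integral_eq_lintegral_ofReal η.integrable_normed
        (Eventually.of_forall η.nonneg_normed), η.integral_normed, ENNReal.ofReal_one]
  have hπint : ∀ f : Rn n → ℝ, ∫ z, f z ∂π = ∫ z, η.normed volume z * f z := by
    intro f
    rw [integral_withDensity_eq_integral_toReal_smul hηm.ennreal_ofReal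
      (Eventually.of_forall fun _ => ENNReal.ofReal_lt_top)]
    refine integral_congr_ae (Eventually.of_forall fun z => ?_)
    simp [ENNReal.toReal_ofReal (η.nonneg_normed z)]
  have hπae : ∀ᵐ z ∂π, ‖z‖ < ε' := by
    rw [ae_withDensity_iff hηm.ennreal_ofReal]
    refine Eventually.of_forall fun z hz => ?_
    have : z ∈ Function.support (η.normed volume) := by
      intro h; simp [h] at hz
    rw [η.support_normed_eq] at this
    simpa using this
  have hφint : ∀ y : Rn n, Integrable (fun z => φ (y - z)) π := fun y =>
    Integrable.of_bound (hm.comp (measurable_const.sub measurable_id)).aestronglyMeasurable k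
      (Eventually.of_forall fun z => hk _)
  have hφloc : LocallyIntegrable φ volume := by
    refine Integrable.locallyIntegrable ?_
    have : φ = (ball x₀ r).indicator φ := by
      ext x; by_cases hx : x ∈ ball x₀ r
      · simp [hx]
      · rw [indicator_of_notMem hx, h0 x hx]
    rw [this, integrable_indicator_iff measurableSet_ball]
    exact Measure.integrableOn_of_bounded measure_ball_lt_top.ne hm.aestronglyMeasurable
      (Eventually.of_forall hk)
  let Φ : Rn n → ℝ := convolution (η.normed volume) φ (ContinuousLinearMap.lsmul ℝ ℝ) volume
  have hΦsm : ContDiff ℝ (⊤ : ℕ∞) Φ :=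
    η.hasCompactSupport_normed.contDiff_convolution_left _ η.contDiff_normed hφloc
  have hΦint : ∀ y, Φ y = ∫ z, φ (y - z) ∂π := by
    intro y
    rw [hπint]
    rfl
  refine ⟨fun x => Φ (a • x + (1 - a) • x₀), ⟨?_, ?_⟩, ?_, ?_⟩
  · exact hΦsm.comp (by fun_prop)
  · have hsupp : tsupport (fun x => Φ (a • x + (1 - a) • x₀)) ⊆ closedBall x₀ ((r + ε') / a) := by
      refine closure_minimal ?_ isClosed_closedBall
      intro x hx
      have h1 := support_convolution_subset (ContinuousLinearMap.lsmul ℝ ℝ) (μ := volume) hx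
      obtain ⟨z, hz, w, hw, hzw⟩ := h1
      rw [η.support_normed_eq] at hz
      have hw' : w ∈ ball x₀ r := by
        by_contra h; exact hw (h0 w h)
      have hz' : ‖z‖ < ε' := by simpa using hz
      rw [mem_ball, dist_eq_norm] at hw'
      rw [mem_closedBall, dist_eq_norm, le_div_iff₀ ha0]
      have h2 : a • (x - x₀) = z + (w - x₀) := by
        have : z + w = a • x + (1 - a) • x₀ := hzw
        rw [← add_sub_assoc, this]; module
      calc ‖x - x₀‖ * a = ‖a • (x - x₀)‖ := by
            rw [norm_smul, Real.norm_of_nonneg ha0.le, mul_comm]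
        _ ≤ ‖z‖ + ‖w - x₀‖ := by rw [h2]; exact norm_add_le _ _
        _ ≤ r + ε' := by linarith
    have hlt : (r + ε') / a < r := by
      rw [div_lt_iff₀ ha0, ha]
      have := min_le_right (δ / 2) (δ / 4 * r)
      nlinarith [mul_pos hδ hr]
    exact ⟨HasCompactSupport.of_support_subset_isCompact (isCompact_closedBall _ _)
      ((subset_tsupport _).trans hsupp), hsupp.trans (closedBall_subset_ball hlt)⟩
  · intro x
    simp only [hΦint]
    simpa using norm_integral_le_of_norm_le_const (μ := π) (C := k)
      (f := fun z => φ (a • x + (1 - a) • x₀ - z)) (Eventually.of_forall fun z => hk _)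
  · have hψm : Measurable fun x => Φ (a • x + (1 - a) • x₀) - φ x :=
      (hΦsm.continuous.measurable.comp (by fun_prop)).sub hm
    rw [gagliardo_univ_eq hp0 hψm]
    have hrep : ∀ X, diffQuot n s p (fun x => Φ (a • x + (1 - a) • x₀) - φ x) X =
        ∫ z, (a ^ κ * U (a • X + ((1 - a) • x₀ - z, (1 - a) • x₀ - z)) - U X) ∂π := by
      intro X
      have e1 : ∀ z, a ^ κ * U (a • X + ((1 - a) • x₀ - z, (1 - a) • x₀ - z)) - U X =
          (φ (a • X.1 + (1 - a) • x₀ - z) - φ (a • X.2 + (1 - a) • x₀ - z)) /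
            ‖X.1 - X.2‖ ^ κ - U X := by
        intro z
        rw [hU, ← diffQuot_comp_affine s p φ ha0, add_sub_assoc, add_sub_assoc]
      simp only [e1]
      have hsub : Integrable (fun z => φ (a • X.1 + (1 - a) • x₀ - z) -
          φ (a • X.2 + (1 - a) • x₀ - z)) π := (hφint _).sub (hφint _)
      rw [integral_sub (hsub.div_const _) (integrable_const _),
        integral_div, integral_sub (hφint _) (hφint _), ← hΦint, ← hΦint, integral_const]
      simp only [hU, diffQuot, probReal_univ, one_smul, ← hκ]
      ring
    have hjm : Measurable fun q : (Rn n × Rn n) × Rn n =>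
        a ^ κ * U (a • q.1 + ((1 - a) • x₀ - q.2, (1 - a) • x₀ - q.2)) - U q.1 := by
      have h1 : Measurable fun q : (Rn n × Rn n) × Rn n =>
        (a • q.1 + ((1 - a) • x₀ - q.2, (1 - a) • x₀ - q.2)) := by fun_prop
      exact ((hUm.comp h1).const_mul _).sub (hUm.comp measurable_fst)
    simp only [hrep]
    refine lintegral_enorm_integral_rpow_le π hp hjm ?_
    filter_upwards [hπae] with z hz using hsmall z hz

/-- The integrand of the energy form of the kernel-`K` fractional `p`-Laplacian. -/
def formIntegrand (n : ℕ) (p : ℝ) (K : Rn n → Rn n → ℝ) (u φ : Rn n → ℝ)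
    (X : Rn n × Rn n) : ℝ :=
  |u X.1 - u X.2| ^ (p - 2) * (u X.1 - u X.2) * (φ X.1 - φ X.2) * K X.1 X.2

theorem KernelBounds.nonneg {n : ℕ} {Λ s p : ℝ} {K : Rn n → Rn n → ℝ} (hK : KernelBounds n Λ s p K)
    (hΛ : 0 ≤ Λ) {x y : Rn n} (hxy : x ≠ y) : 0 ≤ K x y :=
  le_trans (by positivity) (hK.2 x y hxy).1

theorem measurable_formIntegrand {n : ℕ} {Λ s p : ℝ} {K : Rn n → Rn n → ℝ}
    (hK : KernelBounds n Λ s p K) {u φ : Rn n → ℝ} (hu : Measurable u) (hφ : Measurable φ) :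
    Measurable (formIntegrand n p K u φ) := by
  have h := hK.1
  unfold formIntegrand
  have h2 : Measurable fun X : Rn n × Rn n => K X.1 X.2 := h
  fun_prop

theorem abs_rpow_sub_two_mul_self {p : ℝ} (hp : 1 < p) (t : ℝ) :
    |(|t| ^ (p - 2) * t)| = |t| ^ (p - 1) := by
  rcases eq_or_ne t 0 with rfl | ht
  · simp [Real.zero_rpow (by linarith : p - 1 ≠ 0)]
  · rw [abs_mul, abs_of_nonneg (by positivity), ← Real.rpow_add_one (by simpa using ht)]
    congr 1; ring

theorem enorm_formIntegrand_le {n : ℕ} {Λ s p : ℝ} (hp : 1 < p) (hΛ : 0 ≤ Λ)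
    {K : Rn n → Rn n → ℝ} (hK : KernelBounds n Λ s p K) (u φ : Rn n → ℝ) (X : Rn n × Rn n) :
    ‖formIntegrand n p K u φ X‖ₑ ≤
      ENNReal.ofReal Λ * (‖diffQuot n s p u X‖ₑ ^ (p - 1) * ‖diffQuot n s p φ X‖ₑ) := by
  rcases eq_or_ne X.1 X.2 with h | h
  · simp [formIntegrand, h]
  · have hn : 0 < ‖X.1 - X.2‖ := norm_pos_iff.2 (sub_ne_zero.2 h)
    rw [← ofReal_norm, ← ofReal_norm, ← ofReal_norm,
      ENNReal.ofReal_rpow_of_nonneg (norm_nonneg _) (by linarith),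
      ← ENNReal.ofReal_mul (by positivity), ← ENNReal.ofReal_mul hΛ]
    refine ENNReal.ofReal_le_ofReal ?_
    rw [formIntegrand, norm_mul, norm_mul, Real.norm_eq_abs, abs_rpow_sub_two_mul_self hp,
      Real.norm_of_nonneg (hK.nonneg hΛ h)]
    calc _ ≤ |u X.1 - u X.2| ^ (p - 1) * ‖φ X.1 - φ X.2‖ *
          (Λ / ‖X.1 - X.2‖ ^ ((n : ℝ) + s * p)) := by
          gcongr; exact (hK.2 _ _ h).2
      _ = _ := by
        simp only [diffQuot, norm_div, Real.norm_of_nonneg (Real.rpow_nonneg hn.le _)]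
        rw [Real.div_rpow (by positivity) (by positivity), ← Real.rpow_mul hn.le]
        have : (n : ℝ) + s * p = ((n : ℝ) / p + s) * (p - 1) + ((n : ℝ) / p + s) := by
          have : p ≠ 0 := by linarith
          field_simp; ring
        rw [this, Real.rpow_add hn, Real.norm_eq_abs (u _ - u _)]
        field_simp

theorem lintegral_formIntegrand_le {n : ℕ} {Λ s p : ℝ} (hp : 1 < p) (hΛ : 0 ≤ Λ)
    {K : Rn n → Rn n → ℝ} (hK : KernelBounds n Λ s p K) {u φ : Rn n → ℝ} (hu : Measurable u)
    (hφ : Measurable φ) :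
    ∫⁻ X, ‖formIntegrand n p K u φ X‖ₑ ≤ ENNReal.ofReal Λ *
      (gagliardo n s p univ u ^ ((p - 1) / p) * gagliardo n s p univ φ ^ (1 / p)) := by
  have hp0 : 0 < p := by linarith
  have hpq : (p / (p - 1)).HolderConjugate p := (Real.HolderConjugate.conjExponent hp).symm
  have m1 := (measurable_diffQuot s p hu).enorm
  have m2 := (measurable_diffQuot s p hφ).enorm
  calc _ ≤ ∫⁻ X, ENNReal.ofReal Λ * (‖diffQuot n s p u X‖ₑ ^ (p - 1) * ‖diffQuot n s p φ X‖ₑ) :=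
        lintegral_mono fun X => enorm_formIntegrand_le hp hΛ hK u φ X
    _ = ENNReal.ofReal Λ * ∫⁻ X, (‖diffQuot n s p u X‖ₑ ^ (p - 1) * ‖diffQuot n s p φ X‖ₑ) :=
        lintegral_const_mul' _ _ ENNReal.ofReal_ne_top
    _ ≤ _ := by
      gcongr
      refine (ENNReal.lintegral_mul_le_Lp_mul_Lq _ hpq (m1.pow_const _).aemeasurable
        m2.aemeasurable).trans (le_of_eq ?_)
      rw [gagliardo_univ_eq hp0 hu, gagliardo_univ_eq hp0 hφ]
      have h1 : p - 1 ≠ 0 := by linarith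
      congr 2
      · refine lintegral_congr fun X => ?_
        rw [← ENNReal.rpow_mul]
        congr 1; field_simp
      · field_simp

theorem integrable_formIntegrand {n : ℕ} {Λ s p : ℝ} (hp : 1 < p) (hΛ : 0 ≤ Λ)
    {K : Rn n → Rn n → ℝ} (hK : KernelBounds n Λ s p K) {u φ : Rn n → ℝ} (hu : Measurable u)
    (hφ : Measurable φ) (hgu : gagliardo n s p univ u < ⊤) (hgφ : gagliardo n s p univ φ < ⊤) :
    Integrable (formIntegrand n p K u φ) := by
  refine ⟨(measurable_formIntegrand hK hu hφ).aestronglyMeasurable,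
    (lintegral_formIntegrand_le hp hΛ hK hu hφ).trans_lt ?_⟩
  have h1 : 0 ≤ p - 1 := by linarith
  exact ENNReal.mul_lt_top ENNReal.ofReal_lt_top
    (ENNReal.mul_lt_top (ENNReal.rpow_lt_top_of_nonneg (by positivity) hgu.ne)
      (ENNReal.rpow_lt_top_of_nonneg (by positivity) hgφ.ne))

/-- The weak formulations of the two equations, tested with a bounded function of finite energy
vanishing outside the ball. -/
theorem integral_formIntegrand_sub_le {n : ℕ} {Λ s p : ℝ} (hp : 1 < p) (hΛ : 0 ≤ Λ)
    {K : Rn n → Rn n → ℝ} (hK : KernelBounds n Λ s p K) {u v φ μ : Rn n → ℝ} (hu : Measurable u)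
    (hv : Measurable v) (hφ : Measurable φ) (hgu : gagliardo n s p univ u < ⊤)
    (hgv : gagliardo n s p univ v < ⊤) (hgφ : gagliardo n s p univ φ < ⊤)
    (hμ : Integrable μ) {x₀ : Rn n} {r k : ℝ} (hr : 0 < r)
    (hk : ∀ x, |φ x| ≤ k) (h0 : ∀ x, x ∉ ball x₀ r → φ x = 0)
    (hsu : ∀ ψ, IsTestFun n (ball x₀ r) ψ →
      ∫ x, ∫ y, formIntegrand n p K u ψ (x, y) = ∫ x, ψ x * μ x)
    (hsv : ∀ ψ, IsTestFun n (ball x₀ r) ψ → ∫ x, ∫ y, formIntegrand n p K v ψ (x, y) = 0) :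
    (∫ X, formIntegrand n p K u φ X) - ∫ X, formIntegrand n p K v φ X ≤
      k * ∫ x in ball x₀ r, |μ x| := by
  have hp0 : 0 < p := by linarith
  have hex : ∀ j : ℕ, ∃ ψ : Rn n → ℝ, IsTestFun n (ball x₀ r) ψ ∧ (∀ x, |ψ x| ≤ k) ∧
      gagliardo n s p univ (fun x => ψ x - φ x) ≤ ((j : ℝ≥0∞) + 1)⁻¹ := fun j =>
    exists_testFun_gagliardo_sub_le hp.le hφ hk hr h0 hgφ (by simp)
  choose ψ hψt hψk hψg using hex
  have hψm : ∀ j, Measurable (ψ j) := fun j => (hψt j).1.continuous.measurable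
  have hdm : ∀ j, Measurable fun x => ψ j x - φ x := fun j => (hψm j).sub hφ
  have hdg : ∀ j, gagliardo n s p univ (fun x => ψ j x - φ x) < ⊤ := fun j =>
    (hψg j).trans_lt (by simp)
  have hadd : ∀ (w : Rn n → ℝ) j, formIntegrand n p K w (ψ j) =
      formIntegrand n p K w φ + formIntegrand n p K w (fun x => ψ j x - φ x) := by
    intro w j; ext X; simp only [formIntegrand, Pi.add_apply]; ring
  have hint : ∀ w : Rn n → ℝ, Measurable w → gagliardo n s p univ w < ⊤ → ∀ j,
      Integrable (formIntegrand n p K w (ψ j)) := by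
    intro w hw hgw j
    rw [hadd]
    exact (integrable_formIntegrand hp hΛ hK hw hφ hgw hgφ).add
      (integrable_formIntegrand hp hΛ hK hw (hdm j) hgw (hdg j))
  have hlim : ∀ w : Rn n → ℝ, Measurable w → gagliardo n s p univ w < ⊤ →
      Tendsto (fun j => ∫ X, formIntegrand n p K w (ψ j) X) atTop
        (𝓝 (∫ X, formIntegrand n p K w φ X)) := by
    intro w hw hgw
    refine tendsto_integral_of_L1 _ (integrable_formIntegrand hp hΛ hK hw hφ hgw hgφ).1
      (Eventually.of_forall (hint w hw hgw)) ?_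
    have hz : Tendsto (fun j : ℕ => ENNReal.ofReal Λ * (gagliardo n s p univ w ^ ((p - 1) / p) *
        (((j : ℝ≥0∞) + 1)⁻¹) ^ (1 / p))) atTop (𝓝 0) := by
      have h1 : Tendsto (fun j : ℕ => ((j : ℝ≥0∞) + 1)⁻¹) atTop (𝓝 0) := by
        have := ENNReal.tendsto_inv_nat_nhds_zero.comp (tendsto_add_atTop_nat 1)
        simpa [Function.comp_def] using this
      have h2 := (ENNReal.continuous_rpow_const (y := 1 / p)).tendsto 0 |>.comp h1
      rw [ENNReal.zero_rpow_of_pos (by positivity)] at h2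
      have h3 : gagliardo n s p univ w ^ ((p - 1) / p) ≠ ⊤ :=
        (ENNReal.rpow_lt_top_of_nonneg (div_nonneg (by linarith) hp0.le) hgw.ne).ne
      have h4 := ENNReal.Tendsto.const_mul (a := ENNReal.ofReal Λ)
        (ENNReal.Tendsto.const_mul h2 (Or.inr h3)) (Or.inr ENNReal.ofReal_ne_top)
      simpa using h4
    refine tendsto_of_tendsto_of_tendsto_of_le_of_le tendsto_const_nhds hz (fun _ => zero_le) ?_
    intro j
    have : ∀ X, formIntegrand n p K w (ψ j) X - formIntegrand n p K w φ X =
        formIntegrand n p K w (fun x => ψ j x - φ x) X := by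
      intro X; rw [hadd]; simp
    simp only [this]
    refine (lintegral_formIntegrand_le hp hΛ hK hw (hdm j)).trans ?_
    gcongr
    exact hψg j
  refine le_of_tendsto' ((hlim u hu hgu).sub (hlim v hv hgv)) fun j => ?_
  have e1 : ∫ X, formIntegrand n p K u (ψ j) X = ∫ x, ψ j x * μ x := by
    rw [← hsu _ (hψt j)]
    exact integral_prod _ (hint u hu hgu j)
  have e2 : ∫ X, formIntegrand n p K v (ψ j) X = 0 := by
    rw [← hsv _ (hψt j)]
    exact integral_prod _ (hint v hv hgv j)
  rw [e1, e2, sub_zero]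
  have e3 : ∫ x, ψ j x * μ x = ∫ x in ball x₀ r, ψ j x * μ x := by
    refine (setIntegral_eq_integral_of_forall_compl_eq_zero fun x hx => ?_).symm
    rw [image_eq_zero_of_notMem_tsupport fun h => hx ((hψt j).2.2 h), zero_mul]
  rw [e3, ← integral_const_mul]
  have hi : Integrable (fun x => ψ j x * μ x) := hμ.bdd_mul (hψm j).aestronglyMeasurable
    (Eventually.of_forall (hψk j))
  refine integral_mono hi.integrableOn (hμ.abs.const_mul k).integrableOn fun x => ?_
  refine (le_abs_self _).trans ?_
  simp only [abs_mul]
  exact mul_le_mul_of_nonneg_right (hψk j x) (abs_nonneg _)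

theorem sub_rpow_le_abs_rpow_mul_sub {p A B : ℝ} (hp : 2 ≤ p) (hBA : B ≤ A) :
    2 ^ (1 - p) * (A - B) ^ (p - 1) ≤ |A| ^ (p - 2) * A - |B| ^ (p - 2) * B := by
  have hpos : ∀ t : ℝ, 0 ≤ t → |t| ^ (p - 2) * t = t ^ (p - 1) := by
    intro t ht
    have h := abs_rpow_sub_two_mul_self (p := p) (by linarith) t
    rw [abs_of_nonneg (mul_nonneg (by positivity) ht)] at h
    rw [h, abs_of_nonneg ht]
  have hneg : ∀ t : ℝ, t ≤ 0 → |t| ^ (p - 2) * t = -(-t) ^ (p - 1) := by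
    intro t ht
    have := hpos (-t) (by linarith)
    rw [abs_neg] at this
    linarith
  have h2 : (2 : ℝ) ^ (1 - p) ≤ 1 := Real.rpow_le_one_of_one_le_of_nonpos (by norm_num) (by linarith)
  have hAB : 0 ≤ (A - B) ^ (p - 1) := Real.rpow_nonneg (by linarith) _
  have hsup : ∀ a b : ℝ, 0 ≤ b → b ≤ a → (a - b) ^ (p - 1) ≤ a ^ (p - 1) - b ^ (p - 1) := by
    intro a b hb hba
    have := Real.add_rpow_le_rpow_add (p := p - 1) (sub_nonneg.2 hba) hb (by linarith)
    rw [sub_add_cancel] at this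
    linarith
  rcases le_total 0 B with hB | hB
  · rw [hpos A (by linarith), hpos B hB]
    nlinarith [hsup A B hB hBA]
  · rcases le_total 0 A with hA | hA
    · rw [hpos A hA, hneg B hB]
      have hhalf : 2 ^ (1 - p) * (A - B) ^ (p - 1) = ((A - B) / 2) ^ (p - 1) := by
        rw [Real.div_rpow (by linarith) (by norm_num), show 1 - p = -(p - 1) by ring,
          Real.rpow_neg (by norm_num)]
        field_simp
      have hA' := Real.rpow_nonneg hA (p - 1)
      have hB' := Real.rpow_nonneg (neg_nonneg.2 hB) (p - 1)
      rw [hhalf]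
      rcases le_total A (-B) with h | h
      · have := Real.rpow_le_rpow (z := p - 1) (by linarith : 0 ≤ (A - B) / 2)
          (by linarith : (A - B) / 2 ≤ -B) (by linarith)
        linarith
      · have := Real.rpow_le_rpow (z := p - 1) (by linarith : 0 ≤ (A - B) / 2)
          (by linarith : (A - B) / 2 ≤ A) (by linarith)
        linarith
    · rw [hneg A hA, hneg B hB]
      have := hsup (-B) (-A) (by linarith) (by linarith)
      rw [show -B - -A = A - B by ring] at this
      nlinarith

theorem abs_sub_rpow_mul_abs_le {p A B t : ℝ} (hp : 2 ≤ p) (h : 0 ≤ t * (A - B)) :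
    2 ^ (1 - p) * |A - B| ^ (p - 1) * |t| ≤
      (|A| ^ (p - 2) * A - |B| ^ (p - 2) * B) * t := by
  rcases lt_trichotomy A B with hlt | rfl | hlt
  · have ht : t ≤ 0 := by
      by_contra! h'
      nlinarith [mul_pos h' (sub_pos.2 hlt)]
    have := sub_rpow_le_abs_rpow_mul_sub hp hlt.le
    rw [abs_of_nonpos ht, abs_of_neg (sub_neg.2 hlt), neg_sub]
    nlinarith
  · simp [Real.zero_rpow (by linarith : p - 1 ≠ 0)]
  · have ht : 0 ≤ t := by
      by_contra! h'
      nlinarith [mul_pos (neg_pos.2 h') (sub_pos.2 hlt)]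
    have := sub_rpow_le_abs_rpow_mul_sub hp hlt.le
    rw [abs_of_nonneg ht, abs_of_pos (sub_pos.2 hlt)]
    nlinarith

/-- Truncation of a real number to `[-k, k]`. -/
def clamp (k t : ℝ) : ℝ := max (-k) (min k t)

/-- Truncation of a real number between the levels `k` and `2 k`. -/
def levelTrunc (k t : ℝ) : ℝ := clamp k (t - clamp k t)

theorem continuous_clamp (k : ℝ) : Continuous (clamp k) := by
  unfold clamp; fun_prop

theorem continuous_levelTrunc (k : ℝ) : Continuous (levelTrunc k) :=
  (continuous_clamp k).comp (continuous_id.sub (continuous_clamp k))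

theorem clamp_sub_clamp {k a b : ℝ} (h : a ≤ b) :
    0 ≤ clamp k b - clamp k a ∧ clamp k b - clamp k a ≤ b - a := by
  simp only [clamp, max_def, min_def]
  constructor <;> split_ifs <;> linarith

theorem levelTrunc_sub_levelTrunc {k a b : ℝ} (h : a ≤ b) :
    0 ≤ levelTrunc k b - levelTrunc k a ∧ levelTrunc k b - levelTrunc k a ≤ b - a := by
  obtain ⟨h1, h2⟩ := clamp_sub_clamp (k := k) h
  obtain ⟨h3, h4⟩ := clamp_sub_clamp (k := k) (by linarith : a - clamp k a ≤ b - clamp k b)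
  exact ⟨h3, by unfold levelTrunc; linarith⟩

theorem levelTrunc_sub_mul_nonneg (k a b : ℝ) :
    0 ≤ (levelTrunc k a - levelTrunc k b) * (a - b) := by
  rcases le_total a b with h | h
  · have := levelTrunc_sub_levelTrunc (k := k) h
    exact mul_nonneg_of_nonpos_of_nonpos (by linarith) (by linarith)
  · have := levelTrunc_sub_levelTrunc (k := k) h
    exact mul_nonneg this.1 (by linarith)

theorem abs_levelTrunc_sub_le (k a b : ℝ) : |levelTrunc k a - levelTrunc k b| ≤ |a - b| := by
  rcases le_total a b with h | h
  · have := levelTrunc_sub_levelTrunc (k := k) h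
    rw [abs_sub_comm, abs_sub_comm a, abs_of_nonneg this.1, abs_of_nonneg (by linarith)]
    exact this.2
  · have := levelTrunc_sub_levelTrunc (k := k) h
    rw [abs_of_nonneg this.1, abs_of_nonneg (by linarith)]
    exact this.2

theorem abs_levelTrunc_le {k : ℝ} (hk : 0 ≤ k) (t : ℝ) : |levelTrunc k t| ≤ k :=
  abs_le.2 ⟨le_max_left _ _, max_le (by linarith) (min_le_left _ _)⟩

theorem clamp_eq_self {k t : ℝ} (h : |t| ≤ k) : clamp k t = t := by
  obtain ⟨h1, h2⟩ := abs_le.1 h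
  rw [clamp, min_eq_right h2, max_eq_right h1]

theorem levelTrunc_eq_zero {k t : ℝ} (h : |t| ≤ k) : levelTrunc k t = 0 := by
  have hk : 0 ≤ k := (abs_nonneg t).trans h
  rw [levelTrunc, clamp_eq_self h, sub_self, clamp_eq_self (by simpa using hk)]

theorem abs_levelTrunc_eq {k t : ℝ} (hk : 0 ≤ k) (h : 2 * k ≤ |t|) : |levelTrunc k t| = k := by
  rcases le_abs.1 h with h | h
  · have : clamp k t = k := by
      rw [clamp, min_eq_left (by linarith), max_eq_right (by linarith)]
    rw [levelTrunc, this, clamp, min_eq_left (by linarith), max_eq_right (by linarith),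
      abs_of_nonneg hk]
  · have : clamp k t = -k := by
      rw [clamp, min_eq_right (by linarith), max_eq_left (by linarith)]
    rw [levelTrunc, this, clamp, min_eq_right (by linarith), max_eq_left (by linarith), abs_neg,
      abs_of_nonneg hk]

theorem gagliardo_univ_sub_lt_top {n : ℕ} {s p : ℝ} (hp : 1 ≤ p) {u v : Rn n → ℝ}
    (hu : Measurable u) (hv : Measurable v) (hgu : gagliardo n s p univ u < ⊤)
    (hgv : gagliardo n s p univ v < ⊤) : gagliardo n s p univ (fun x => u x - v x) < ⊤ := by
  have hp0 : 0 < p := by linarith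
  have h := (memLp_diffQuot hp0 hu hgu).sub (memLp_diffQuot hp0 hv hgv)
  have e : diffQuot n s p u - diffQuot n s p v = diffQuot n s p (fun x => u x - v x) := by
    ext X; simp only [diffQuot, Pi.sub_apply]; ring
  rw [e] at h
  have h2 := h.2
  rw [eLpNorm_lt_top_iff_lintegral_rpow_enorm_lt_top (by simpa using hp0) ENNReal.ofReal_ne_top,
    ENNReal.toReal_ofReal hp0.le] at h2
  rw [gagliardo_univ_eq hp0 (show Measurable fun x => u x - v x from hu.sub hv)]
  exact h2

theorem gagliardo_mono_of_abs_sub_le {n : ℕ} {s p : ℝ} (hp : 0 ≤ p) {O : Set (Rn n)}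
    {v w : Rn n → ℝ} (h : ∀ x y, |v x - v y| ≤ |w x - w y|) :
    gagliardo n s p O v ≤ gagliardo n s p O w := by
  refine lintegral_mono fun x => lintegral_mono fun y => ENNReal.ofReal_le_ofReal ?_
  have := h x y
  gcongr

/-- A set of small measure interacts nonlocally with its complement. -/
theorem le_setLIntegral_compl_div_rpow {n : ℕ} {N c m ρ : ℝ} (hN : 0 ≤ N) (hc : 0 ≤ c)
    {E : Set (Rn n)}
    (hE : MeasurableSet E) (hm : volume E = ENNReal.ofReal m) (hm0 : 0 ≤ m) (hρ : 0 < ρ)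
    (hball : ENNReal.ofReal (2 * m) ≤ volume (ball (0 : Rn n) ρ)) {x : Rn n} (hx : x ∈ E) :
    ENNReal.ofReal (c / ρ ^ N * m) ≤ ∫⁻ y in Eᶜ, ENNReal.ofReal (c / ‖x - y‖ ^ N) := by
  have h1 : ENNReal.ofReal m ≤ volume (ball x ρ \ E) := by
    calc ENNReal.ofReal m = ENNReal.ofReal (2 * m) - ENNReal.ofReal m := by
          rw [← ENNReal.ofReal_sub _ hm0]; congr 1; ring
      _ ≤ volume (ball x ρ) - volume E := by
          rw [hm, Measure.addHaar_ball_center]; gcongr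
      _ ≤ _ := le_measure_sdiff
  calc ENNReal.ofReal (c / ρ ^ N * m) = ENNReal.ofReal (c / ρ ^ N) * ENNReal.ofReal m :=
        ENNReal.ofReal_mul (by positivity)
    _ ≤ ENNReal.ofReal (c / ρ ^ N) * volume (ball x ρ \ E) := by gcongr
    _ = ∫⁻ _ in ball x ρ \ E, ENNReal.ofReal (c / ρ ^ N) := by rw [setLIntegral_const]
    _ ≤ ∫⁻ y in ball x ρ \ E, ENNReal.ofReal (c / ‖x - y‖ ^ N) := by
        refine setLIntegral_mono' (measurableSet_ball.diff hE) fun y hy => ?_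
        have hne : x ≠ y := fun h => hy.2 (h ▸ hx)
        have hpos : 0 < ‖x - y‖ := norm_pos_iff.2 (sub_ne_zero.2 hne)
        have hlt : ‖x - y‖ < ρ := by
          have := hy.1; rwa [mem_ball, dist_comm, dist_eq_norm] at this
        gcongr
    _ ≤ _ := lintegral_mono_set fun y hy => hy.2

/-- Testing with a level truncation of `u - v` bounds the measure of its superlevel sets. -/
theorem measureReal_superlevel_mul_le {n : ℕ} {Λ s p : ℝ} (hp : 2 ≤ p) (hN : 0 ≤ (n : ℝ) + s * p)
    (hΛ : 0 < Λ) {K : Rn n → Rn n → ℝ} (hK : KernelBounds n Λ s p K) {u v μ : Rn n → ℝ}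
    (hu : Measurable u) (hv : Measurable v) (hgu : gagliardo n s p univ u < ⊤)
    (hgv : gagliardo n s p univ v < ⊤) (hμ : Integrable μ) {x₀ : Rn n} {r k : ℝ} (hr : 0 < r)
    (hk : 0 < k) (hoff : ∀ x, x ∉ ball x₀ r → v x = u x)
    (hsu : ∀ ψ, IsTestFun n (ball x₀ r) ψ →
      ∫ x, ∫ y, formIntegrand n p K u ψ (x, y) = ∫ x, ψ x * μ x)
    (hsv : ∀ ψ, IsTestFun n (ball x₀ r) ψ → ∫ x, ∫ y, formIntegrand n p K v ψ (x, y) = 0)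
    {ρ : ℝ} (hρ : 0 < ρ)
    (hball : ENNReal.ofReal (2 * volume.real {x | k < |u x - v x|}) ≤
      volume (ball (0 : Rn n) ρ)) :
    volume.real {x | 2 * k < |u x - v x|} *
        (2 ^ (1 - p) * k ^ p / Λ / ρ ^ ((n : ℝ) + s * p) * volume.real {x | k < |u x - v x|}) ≤
      k * ∫ x in ball x₀ r, |μ x| := by
  have hp1 : 1 < p := by linarith
  have hsub : ∀ t : ℝ, 0 < t → {x | t < |u x - v x|} ⊆ ball x₀ r := by
    intro t ht x hx
    by_contra h
    simp only [mem_ofPred_eq, hoff x h, sub_self, abs_zero] at hx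
    linarith
  have hfin : ∀ t : ℝ, 0 < t → volume {x | t < |u x - v x|} ≠ ⊤ := fun t ht =>
    ((measure_mono (hsub t ht)).trans_lt measure_ball_lt_top).ne
  have hmeas : ∀ t : ℝ, MeasurableSet {x | t < |u x - v x|} := fun t =>
    measurableSet_lt measurable_const (by fun_prop)
  set φ : Rn n → ℝ := fun x => levelTrunc k (u x - v x) with hφ
  have hφm : Measurable φ := (continuous_levelTrunc k).measurable.comp (hu.sub hv)
  have hgφ : gagliardo n s p univ φ < ⊤ :=
    (gagliardo_mono_of_abs_sub_le (by linarith)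
      fun x y => abs_levelTrunc_sub_le k _ _).trans_lt
      (gagliardo_univ_sub_lt_top hp1.le hu hv hgu hgv)
  have iu := integrable_formIntegrand hp1 hΛ.le hK hu hφm hgu hgφ
  have iv := integrable_formIntegrand hp1 hΛ.le hK hv hφm hgv hgφ
  have hmain := integral_formIntegrand_sub_le hp1 hΛ.le hK hu hv hφm hgu hgv hgφ hμ hr
    (fun x => abs_levelTrunc_le hk.le _)
    (fun x hx => levelTrunc_eq_zero (by simpa [hoff x hx] using hk.le)) hsu hsv
  rw [← integral_sub iu iv] at hmain
  set G : Rn n × Rn n → ℝ := fun X => formIntegrand n p K u φ X - formIntegrand n p K v φ X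
    with hG
  have hlow : ∀ x y, x ≠ y → 2 ^ (1 - p) * |(u x - v x) - (u y - v y)| ^ (p - 1) *
      |φ x - φ y| * K x y ≤ G (x, y) := by
    intro x y hxy
    have h1 := abs_sub_rpow_mul_abs_le (A := u x - u y) (B := v x - v y) (t := φ x - φ y) hp (by
      have := levelTrunc_sub_mul_nonneg k (u x - v x) (u y - v y)
      convert this using 2; ring)
    have h2 := mul_le_mul_of_nonneg_right h1 (hK.nonneg hΛ.le hxy)
    rw [show u x - u y - (v x - v y) = (u x - v x) - (u y - v y) by ring] at h2
    refine h2.trans_eq ?_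
    simp only [hG, formIntegrand]; ring
  have hG0 : ∀ X, 0 ≤ G X := by
    rintro ⟨x, y⟩
    rcases eq_or_ne x y with rfl | h
    · simp [hG, formIntegrand]
    · have := hK.nonneg hΛ.le h
      exact le_trans (by positivity) (hlow x y h)
  have hGm : Measurable G :=
    (measurable_formIntegrand hK hu hφm).sub (measurable_formIntegrand hK hv hφm)
  set D := {x | 2 * k < |u x - v x|} with hD
  set E := {x | k < |u x - v x|} with hE
  set c := 2 ^ (1 - p) * k ^ p / Λ with hc
  have hDE : D ⊆ E := fun x hx => lt_trans (by linarith) (show 2 * k < |u x - v x| from hx)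
  have hDG : ∀ x ∈ D, ∀ y ∈ Eᶜ, c / ‖x - y‖ ^ ((n : ℝ) + s * p) ≤ G (x, y) := by
    intro x hx y hy
    have hxy : x ≠ y := fun h => hy (h ▸ hDE hx)
    have hx' : 2 * k < |u x - v x| := hx
    have hy' : |u y - v y| ≤ k := not_lt.1 hy
    refine le_trans ?_ (hlow x y hxy)
    have e1 : |φ x - φ y| = k := by
      rw [hφ]
      simp only [levelTrunc_eq_zero hy', sub_zero]
      exact abs_levelTrunc_eq hk.le hx'.le
    have e2 : k ≤ |(u x - v x) - (u y - v y)| := by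
      have := abs_sub_abs_le_abs_sub (u x - v x) (u y - v y)
      linarith
    have e3 : k ^ p = k ^ (p - 1) * k := by
      rw [← Real.rpow_add_one hk.ne']; congr 1; ring
    calc c / ‖x - y‖ ^ ((n : ℝ) + s * p)
        = 2 ^ (1 - p) * k ^ (p - 1) * k * (1 / (Λ * ‖x - y‖ ^ ((n : ℝ) + s * p))) := by
          rw [hc, e3]; ring
      _ ≤ _ := by
          rw [e1]
          gcongr
          exact (hK.2 x y hxy).1
  have hint : ENNReal.ofReal (volume.real D * (c / ρ ^ ((n : ℝ) + s * p) * volume.real E)) ≤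
      ENNReal.ofReal (∫ X, G X) := by
    rw [ofReal_integral_eq_lintegral_ofReal (f := G) (iu.sub iv) (ae_of_all _ hG0),
      ENNReal.ofReal_mul measureReal_nonneg, ofReal_measureReal (hfin _ (by linarith)), mul_comm]
    calc ENNReal.ofReal (c / ρ ^ ((n : ℝ) + s * p) * volume.real E) * volume D
        = ∫⁻ _ in D, ENNReal.ofReal (c / ρ ^ ((n : ℝ) + s * p) * volume.real E) := by
          rw [setLIntegral_const]
      _ ≤ ∫⁻ x in D, ∫⁻ y, ENNReal.ofReal (G (x, y)) := by
          refine setLIntegral_mono' (hmeas _) fun x hx => ?_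
          calc _ ≤ ∫⁻ y in Eᶜ, ENNReal.ofReal (c / ‖x - y‖ ^ ((n : ℝ) + s * p)) :=
                le_setLIntegral_compl_div_rpow hN (by positivity) (hmeas _)
                  (ofReal_measureReal (hfin _ hk)).symm measureReal_nonneg hρ hball (hDE hx)
            _ ≤ ∫⁻ y in Eᶜ, ENNReal.ofReal (G (x, y)) :=
                setLIntegral_mono' (hmeas _).compl fun y hy =>
                  ENNReal.ofReal_le_ofReal (hDG x hx y hy)
            _ ≤ _ := setLIntegral_le_lintegral _ _
      _ ≤ ∫⁻ x, ∫⁻ y, ENNReal.ofReal (G (x, y)) := setLIntegral_le_lintegral _ _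
      _ = _ := by
          rw [Measure.volume_eq_prod, lintegral_prod _ hGm.ennreal_ofReal.aemeasurable]
  exact ((ENNReal.ofReal_le_ofReal_iff (integral_nonneg hG0)).1 hint).trans hmain

/-- Recursive decay of the normalised measure of the superlevel sets. -/
theorem superlevel_ratio_le {n : ℕ} {s p Λ ω r d k a b M θ : ℝ} (hn : 0 < n) (hs : 0 < s)
    (hp : 1 < p) (hΛ : 0 < Λ) (hω : 0 < ω) (hr : 0 < r) (hd : 0 < d) (hk : 0 < k)
    (hb : 0 < b) (hbr : b ≤ ω * r ^ n) (hM : M ≤ d ^ (p - 1) * r ^ ((n : ℝ) - s * p))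
    (hθ : 0 ≤ θ) (hθs : θ ≤ s * p / n)
    (h : a * (2 ^ (1 - p) * k ^ p / Λ / ((2 * b / ω) ^ (1 / (n : ℝ))) ^ ((n : ℝ) + s * p) * b) ≤
      k * M) :
    a / (ω * r ^ n) ≤
      (2 ^ (p - 1) * Λ * 2 ^ (1 + s * p / n) / ω ^ 2) * (d / k) ^ (p - 1) * (b / (ω * r ^ n)) ^ θ := by
  have hn' : (0 : ℝ) < n := by exact_mod_cast hn
  set σ := s * p / n with hσ
  have hσ0 : 0 ≤ σ := by positivity
  set e := b / (ω * r ^ n) with he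
  have hb' : b = e * (ω * r ^ n) := by rw [he]; field_simp
  have he0 : 0 < e := by positivity
  have he1 : e ≤ 1 := by rw [he]; exact (div_le_one (by positivity)).2 hbr
  have hρ : ((2 * b / ω) ^ (1 / (n : ℝ))) ^ ((n : ℝ) + s * p) = 2 * (e * r ^ n) *
      (2 ^ σ * e ^ σ * r ^ (s * p)) := by
    rw [← Real.rpow_mul (by positivity), show 1 / (n : ℝ) * (n + s * p) = 1 + σ by
      rw [hσ]; field_simp, show 2 * b / ω = 2 * (e * r ^ n) by rw [hb']; field_simp,
      Real.rpow_add (by positivity), Real.rpow_one, Real.mul_rpow (by positivity) (by positivity),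
      Real.mul_rpow (by positivity) (by positivity), ← Real.rpow_natCast r n,
      ← Real.rpow_mul hr.le, show (n : ℝ) * σ = s * p by rw [hσ]; field_simp, mul_assoc (2 ^ σ)]
  have hkp : k ^ p = k ^ (p - 1) * k := by
    rw [← Real.rpow_add_one hk.ne']; congr 1; ring
  have hrn : r ^ ((n : ℝ) - s * p) = r ^ n / r ^ (s * p) := by
    rw [Real.rpow_sub hr, Real.rpow_natCast]
  have h2 : (2 : ℝ) ^ (1 - p) = (2 ^ (p - 1))⁻¹ := by
    rw [← Real.rpow_neg (by norm_num)]; congr 1; ring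
  have h3 : (2 : ℝ) ^ (1 + σ) = 2 * 2 ^ σ := by
    rw [Real.rpow_add (by norm_num), Real.rpow_one]
  have h4 := h.trans (mul_le_mul_of_nonneg_left hM hk.le)
  rw [hρ, hkp, hrn, h2, hb'] at h4
  have hrs : 0 < r ^ (s * p) := by positivity
  have hkk : 0 < k ^ (p - 1) := by positivity
  have heσ : 0 < e ^ σ := by positivity
  have h5 : a / (ω * r ^ n) ≤ (2 ^ (p - 1) * Λ * 2 ^ (1 + σ) / ω ^ 2) * (d / k) ^ (p - 1) * e ^ σ := by
    rw [h3, Real.div_rpow hd.le hk.le, div_le_iff₀ (by positivity)]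
    set Q := (2 ^ (p - 1))⁻¹ * (k ^ (p - 1) * k) / Λ /
      (2 * (e * r ^ n) * (2 ^ σ * e ^ σ * r ^ (s * p))) * (e * (ω * r ^ n)) with hQ
    have hQ0 : 0 < Q := by positivity
    rw [← le_div_iff₀ hQ0] at h4
    refine h4.trans_eq ?_
    rw [hQ]
    field_simp
  refine h5.trans ?_
  gcongr ?_ * ?_
  exact Real.rpow_le_rpow_of_exponent_ge' he0.le he1 hθ hθs

/-- A recursive inequality between dyadic superlevel sets yields geometric decay. -/
theorem exists_geometric_decay {α θ C : ℝ} (hα : 0 < α) (hθ0 : 0 ≤ θ) (hθ1 : θ < 1)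
    (hC : 1 ≤ C) :
    ∃ C' : ℝ, 0 < C' ∧ ∀ (e : ℝ → ℝ) (d : ℝ), 0 < d → (∀ k, 0 < k → 0 ≤ e k) →
      (∀ k, 0 < k → e k ≤ 1) → (∀ k, 0 < k → e (2 * k) ≤ C * (d / k) ^ α * e k ^ θ) →
      ∀ j : ℕ, e (2 ^ j * d) ≤ C' * ((2 : ℝ) ^ (-(α / (1 - θ)))) ^ j := by
  have hθ : 0 < 1 - θ := by linarith
  set β := α / (1 - θ) with hβ
  have hβ0 : 0 < β := by positivity
  have h2β : (1 : ℝ) ≤ 2 ^ β := Real.one_le_rpow (by norm_num) hβ0.le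
  have hA : 1 ≤ C * 2 ^ β := by nlinarith
  have hA0 : 0 < C * 2 ^ β := by linarith
  have hC' : C * 2 ^ β * ((C * 2 ^ β) ^ (1 / (1 - θ))) ^ θ = (C * 2 ^ β) ^ (1 / (1 - θ)) := by
    rw [← Real.rpow_mul hA0.le]
    conv_lhs => enter [1]; rw [← Real.rpow_one (C * 2 ^ β)]
    rw [← Real.rpow_add hA0]
    congr 1
    field_simp
    ring
  set C' := (C * 2 ^ β) ^ (1 / (1 - θ)) with hC'def
  have hC'1 : 1 ≤ C' := Real.one_le_rpow hA (by positivity)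
  refine ⟨C', by linarith, fun e d hd he0 he1 hrec j => ?_⟩
  induction j with
  | zero => simpa using (he1 d hd).trans hC'1
  | succ j ih =>
    have hk : 0 < 2 ^ j * d := by positivity
    have hq : (0 : ℝ) < 2 ^ (-β) := by positivity
    have hdk : (d / (2 ^ j * d)) ^ α = ((2 : ℝ) ^ (-α)) ^ j := by
      rw [show d / (2 ^ j * d) = (2 ^ j)⁻¹ by field_simp, Real.inv_rpow (by positivity),
        ← Real.rpow_natCast, ← Real.rpow_natCast, ← Real.rpow_mul (by norm_num),
        ← Real.rpow_mul (by norm_num), ← Real.rpow_neg (by norm_num)]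
      congr 1; ring
    have hexp : (2 : ℝ) ^ (-α) * (2 ^ (-β)) ^ θ = 2 ^ (-β) := by
      rw [← Real.rpow_mul (by norm_num), ← Real.rpow_add (by norm_num)]
      congr 1
      rw [hβ]; field_simp; ring
    have hqj : (((2 : ℝ) ^ (-β)) ^ j) ^ θ = ((2 ^ (-β)) ^ θ) ^ j := by
      rw [← Real.rpow_natCast, ← Real.rpow_natCast, ← Real.rpow_mul hq.le, ← Real.rpow_mul hq.le,
        mul_comm]
    calc e (2 ^ (j + 1) * d) = e (2 * (2 ^ j * d)) := by congr 1; ring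
      _ ≤ C * (d / (2 ^ j * d)) ^ α * e (2 ^ j * d) ^ θ := hrec _ hk
      _ ≤ C * ((2 : ℝ) ^ (-α)) ^ j * (C' * (2 ^ (-β)) ^ j) ^ θ := by
          rw [hdk]
          have := he0 _ hk
          gcongr
      _ = C * C' ^ θ * (2 ^ (-α) * (2 ^ (-β)) ^ θ) ^ j := by
          rw [Real.mul_rpow (by linarith) (by positivity), hqj, mul_pow]; ring
      _ = C * 2 ^ β * C' ^ θ * (2 ^ (-β)) ^ (j + 1) := by
          rw [hexp, pow_succ, Real.rpow_neg (by norm_num) β]; field_simp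
      _ = _ := by rw [hC']

theorem ofReal_abs_rpow_le_tsum {α : Type*} {w : α → ℝ} {d γ : ℝ} (hd : 0 < d) (hγ : 0 < γ)
    (x : α) :
    ENNReal.ofReal (|w x| ^ γ) ≤ ENNReal.ofReal (d ^ γ) +
      ∑' j : ℕ, {y | 2 ^ j * d < |w y|}.indicator
        (fun _ => ENNReal.ofReal ((2 ^ (j + 1) * d) ^ γ)) x := by
  rcases le_or_gt |w x| d with h | h
  · exact le_add_right (ENNReal.ofReal_le_ofReal (by gcongr))
  · have hex : ∃ j : ℕ, |w x| ≤ 2 ^ j * d := by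
      obtain ⟨j, hj⟩ := pow_unbounded_of_one_lt (|w x| / d) (by norm_num : (1 : ℝ) < 2)
      exact ⟨j, ((div_lt_iff₀ hd).1 hj).le⟩
    classical
    have h1 := Nat.find_spec hex
    have h2 : ∀ i < Nat.find hex, ¬ |w x| ≤ 2 ^ i * d := fun i hi => Nat.find_min hex hi
    rcases hj : Nat.find hex with _ | i
    · rw [hj] at h1; simp at h1; linarith
    · rw [hj] at h1
      have h3 := not_le.1 (h2 i (by omega))
      refine le_add_left (le_trans ?_ (ENNReal.le_tsum i))
      rw [indicator_of_mem (by exact h3)]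
      exact ENNReal.ofReal_le_ofReal (by gcongr)

/-- Geometric decay of the superlevel sets gives a bound on the moments. -/
theorem lintegral_rpow_le_of_geometric_decay {α : Type*} [MeasurableSpace α] {ν : Measure α}
    {w : α → ℝ} (hw : Measurable w) {d γ β C V : ℝ} (hd : 0 < d) (hγ : 0 < γ) (hγβ : γ < β)
    (hC : 0 ≤ C) (hV : 0 ≤ V) (hν : ν univ ≤ ENNReal.ofReal V)
    (h : ∀ j : ℕ, ν {x | 2 ^ j * d < |w x|} ≤ ENNReal.ofReal (C * (2 ^ (-β)) ^ j * V)) :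
    ∫⁻ x, ENNReal.ofReal (|w x| ^ γ) ∂ν ≤
      ENNReal.ofReal ((1 + 2 ^ γ * C * (1 - 2 ^ (γ - β))⁻¹) * d ^ γ * V) := by
  have hmeas : ∀ j : ℕ, MeasurableSet {x | 2 ^ j * d < |w x|} := fun j =>
    measurableSet_lt measurable_const (by fun_prop)
  have hr0 : (0 : ℝ) ≤ 2 ^ (γ - β) := by positivity
  have hr1 : (2 : ℝ) ^ (γ - β) < 1 := Real.rpow_lt_one_of_one_lt_of_neg (by norm_num) (by linarith)
  have hterm : ∀ j : ℕ, ((2 ^ (j + 1) * d) ^ γ) * (C * ((2 : ℝ) ^ (-β)) ^ j * V) =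
      2 ^ γ * C * d ^ γ * V * (2 ^ (γ - β)) ^ j := by
    intro j
    have e1 : ((2 : ℝ) ^ (j + 1) * d) ^ γ = 2 ^ γ * (2 ^ γ) ^ j * d ^ γ := by
      rw [Real.mul_rpow (by positivity) hd.le, ← Real.rpow_natCast 2, ← Real.rpow_natCast _ j,
        ← Real.rpow_mul (by norm_num), ← Real.rpow_mul (by norm_num),
        ← Real.rpow_add (by norm_num)]
      congr 2; push_cast; ring
    have e2 : ((2 : ℝ) ^ (γ - β)) ^ j = (2 ^ γ) ^ j * (2 ^ (-β)) ^ j := by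
      rw [sub_eq_add_neg, Real.rpow_add (by norm_num), mul_pow]
    rw [e1, e2]; ring
  calc ∫⁻ x, ENNReal.ofReal (|w x| ^ γ) ∂ν
      ≤ ∫⁻ x, (ENNReal.ofReal (d ^ γ) + ∑' j : ℕ, {y | 2 ^ j * d < |w y|}.indicator
        (fun _ => ENNReal.ofReal ((2 ^ (j + 1) * d) ^ γ)) x) ∂ν :=
        lintegral_mono fun x => ofReal_abs_rpow_le_tsum hd hγ x
    _ = ENNReal.ofReal (d ^ γ) * ν univ + ∑' j : ℕ, ENNReal.ofReal ((2 ^ (j + 1) * d) ^ γ) *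
          ν {y | 2 ^ j * d < |w y|} := by
        rw [lintegral_add_left measurable_const, lintegral_const, lintegral_tsum fun j =>
          (measurable_const.indicator (hmeas j)).aemeasurable]
        simp only [lintegral_indicator_const (hmeas _)]
    _ ≤ ENNReal.ofReal (d ^ γ) * ENNReal.ofReal V + ∑' j : ℕ,
          ENNReal.ofReal (2 ^ γ * C * d ^ γ * V * (2 ^ (γ - β)) ^ j) := by
        gcongr with j
        rw [← hterm, ENNReal.ofReal_mul (by positivity)]
        gcongr
        exact h j
    _ = _ := by
        rw [← ENNReal.ofReal_tsum_of_nonneg (fun j => by positivity)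
          ((summable_geometric_of_lt_one hr0 hr1).mul_left _), tsum_mul_left,
          tsum_geometric_of_lt_one hr0 hr1, ← ENNReal.ofReal_mul (by positivity),
          ← ENNReal.ofReal_add (by positivity)]
        · congr 1; ring
        · have : 0 < 1 - (2 : ℝ) ^ (γ - β) := by linarith
          positivity

theorem exists_exponent {n : ℕ} {s p γ : ℝ} (hn : 0 < n) (hs : 0 < s) (hp : 1 < p) (hγ1 : 1 ≤ γ)
    (hγ : p < (n : ℝ) / s → γ < (n : ℝ) * (p - 1) / ((n : ℝ) - p * s)) :
    ∃ θ : ℝ, 0 ≤ θ ∧ θ < 1 ∧ θ ≤ s * p / n ∧ γ < (p - 1) / (1 - θ) := by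
  have hn' : (0 : ℝ) < n := by exact_mod_cast hn
  have hp1 : 0 < p - 1 := by linarith
  rcases lt_or_ge (s * p) n with h | h
  · have h1 := hγ ((lt_div_iff₀ hs).2 (by linarith))
    have h2 : s * p / n < 1 := (div_lt_one hn').2 h
    refine ⟨s * p / n, by positivity, h2, le_rfl, h1.trans_eq ?_⟩
    have h3 : (n : ℝ) - p * s ≠ 0 := by linarith
    have h4 : 1 - s * p / n ≠ 0 := by linarith
    rw [div_eq_div_iff h3 h4]
    field_simp
  · have h2 : 1 ≤ s * p / n := (one_le_div hn').2 h
    rcases le_or_gt (2 * γ) (p - 1) with h3 | h3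
    · exact ⟨0, le_rfl, one_pos, by linarith, by rw [sub_zero, div_one]; linarith⟩
    · have h4 : (p - 1) / (2 * γ) < 1 := (div_lt_one (by linarith)).2 h3
      have h5 : 0 < (p - 1) / (2 * γ) := by positivity
      refine ⟨1 - (p - 1) / (2 * γ), by linarith, by linarith, by linarith, ?_⟩
      rw [sub_sub_cancel, div_div_cancel₀ hp1.ne']
      linarith

theorem volume_ball_eq {n : ℕ} (x : Rn n) {r : ℝ} (hr : 0 < r) :
    volume (ball x r) = ENNReal.ofReal (volume.real (ball (0 : Rn n) 1) * r ^ n) := by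
  rw [Measure.addHaar_ball_of_pos _ _ hr, finrank_euclideanSpace_fin, mul_comm (volume.real _),
    ENNReal.ofReal_mul (by positivity), ofReal_measureReal measure_ball_lt_top.ne]

/-- The comparison estimate for everywhere defined measurable representatives. -/
theorem exists_const_lintegral_rpow_le {n : ℕ} {s p Λ γ : ℝ} (hn : 0 < n) (hs : 0 < s)
    (hp : 2 ≤ p) (hΛ : 1 ≤ Λ) (hγ1 : 1 ≤ γ)
    (hγ : p < (n : ℝ) / s → γ < (n : ℝ) * (p - 1) / ((n : ℝ) - p * s)) :
    ∃ C : ℝ, 0 < C ∧ ∀ (K : Rn n → Rn n → ℝ) (μ u v : Rn n → ℝ) (x₀ : Rn n) (r d : ℝ),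
      KernelBounds n Λ s p K → Measurable u → Measurable v → gagliardo n s p univ u < ⊤ →
      gagliardo n s p univ v < ⊤ → Integrable μ → 0 < r → 0 < d →
      (∀ x, x ∉ ball x₀ r → v x = u x) →
      (∀ ψ, IsTestFun n (ball x₀ r) ψ →
        ∫ x, ∫ y, formIntegrand n p K u ψ (x, y) = ∫ x, ψ x * μ x) →
      (∀ ψ, IsTestFun n (ball x₀ r) ψ → ∫ x, ∫ y, formIntegrand n p K v ψ (x, y) = 0) →
      ∫ x in ball x₀ r, |μ x| ≤ d ^ (p - 1) * r ^ ((n : ℝ) - s * p) →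
      ∫⁻ x in ball x₀ r, ENNReal.ofReal (|u x - v x| ^ γ) ≤
        ENNReal.ofReal (C * d ^ γ) * volume (ball x₀ r) := by
  have hΛ0 : 0 < Λ := by linarith
  have hp1 : 0 < p - 1 := by linarith
  obtain ⟨θ, hθ0, hθ1, hθs, hγθ⟩ := exists_exponent hn hs (by linarith) hγ1 hγ
  set ω := volume.real (ball (0 : Rn n) 1) with hω
  have hω0 : 0 < ω :=
    ENNReal.toReal_pos (measure_ball_pos _ _ one_pos).ne' measure_ball_lt_top.ne
  obtain ⟨C', hC', hdecay⟩ := exists_geometric_decay hp1 hθ0 hθ1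
    (le_max_left 1 (2 ^ (p - 1) * Λ * 2 ^ (1 + s * p / n) / ω ^ 2))
  set C₁ := max 1 (2 ^ (p - 1) * Λ * 2 ^ (1 + s * p / n) / ω ^ 2) with hC₁
  set β := (p - 1) / (1 - θ) with hβ
  have hr1 : (2 : ℝ) ^ (γ - β) < 1 := Real.rpow_lt_one_of_one_lt_of_neg (by norm_num) (by linarith)
  have hC0 : 0 < 1 + 2 ^ γ * C' * (1 - 2 ^ (γ - β))⁻¹ := by
    have : 0 < 1 - (2 : ℝ) ^ (γ - β) := by linarith
    positivity
  refine ⟨_, hC0, fun K μ u v x₀ r d hK hu hv hgu hgv hμ hr hd hoff hsu hsv hM => ?_⟩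
  have hV : 0 < ω * r ^ n := by positivity
  have hsub : ∀ t : ℝ, 0 < t → {x | t < |u x - v x|} ⊆ ball x₀ r := by
    intro t ht x hx
    by_contra h
    simp only [mem_ofPred_eq, hoff x h, sub_self, abs_zero] at hx
    linarith
  have hle : ∀ t : ℝ, 0 < t → volume.real {x | t < |u x - v x|} ≤ ω * r ^ n := by
    intro t ht
    refine ENNReal.toReal_le_of_le_ofReal hV.le ?_
    rw [← volume_ball_eq x₀ hr]
    exact measure_mono (hsub t ht)
  have hfin : ∀ t : ℝ, 0 < t → volume {x | t < |u x - v x|} ≠ ⊤ := fun t ht =>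
    ((measure_mono (hsub t ht)).trans_lt measure_ball_lt_top).ne
  have hdec := hdecay (fun t => volume.real {x | t < |u x - v x|} / (ω * r ^ n)) d hd
    (fun k _ => by positivity) (fun k hk => (div_le_one hV).2 (hle k hk)) (fun k hk => by
      rcases (measureReal_nonneg (μ := volume) (s := {x | k < |u x - v x|})).eq_or_lt with h0 | h0
      · have : volume.real {x | 2 * k < |u x - v x|} = 0 :=
          le_antisymm ((measureReal_mono (fun x hx => lt_trans (by linarith)
            (show 2 * k < |u x - v x| from hx)) (hfin k hk)).trans h0.ge) measureReal_nonneg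
        simp only [this, zero_div]
        positivity
      · have hρ : 0 < (2 * volume.real {x | k < |u x - v x|} / ω) ^ (1 / (n : ℝ)) := by positivity
        have h1 := measureReal_superlevel_mul_le hp (by positivity) hΛ0 hK hu hv hgu hgv hμ hr hk
          hoff hsu hsv hρ (by
            rw [volume_ball_eq _ hρ, ← hω, ← Real.rpow_natCast, ← Real.rpow_mul (by positivity),
              one_div_mul_cancel (by positivity), Real.rpow_one]
            refine ENNReal.ofReal_le_ofReal (le_of_eq ?_)
            field_simp)
        refine (superlevel_ratio_le hn hs (by linarith) hΛ0 hω0 hr hd hk h0 (hle k hk) hM hθ0 hθs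
          h1).trans ?_
        gcongr
        exact le_max_right _ _)
  have hfinal := lintegral_rpow_le_of_geometric_decay (ν := volume.restrict (ball x₀ r))
    (w := fun x => u x - v x) (hu.sub hv) hd (by linarith) hγθ hC'.le hV.le
    (by rw [Measure.restrict_apply_univ, volume_ball_eq _ hr]) (fun j => by
      have hj : 0 < 2 ^ j * d := by positivity
      have := (div_le_iff₀ hV).1 (hdec j)
      calc _ ≤ volume {x | 2 ^ j * d < |u x - v x|} := Measure.restrict_apply_le _ _
        _ = ENNReal.ofReal (volume.real {x | 2 ^ j * d < |u x - v x|}) :=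
          (ofReal_measureReal (hfin _ hj)).symm
        _ ≤ _ := ENNReal.ofReal_le_ofReal this)
  rwa [ENNReal.ofReal_mul (by positivity), ← volume_ball_eq x₀ hr] at hfinal

theorem gagliardo_univ_congr_ae {n : ℕ} {s p : ℝ} {v w : Rn n → ℝ} (h : v =ᵐ[volume] w) :
    gagliardo n s p univ v = gagliardo n s p univ w := by
  simp only [gagliardo, Measure.restrict_univ]
  refine lintegral_congr_ae ?_
  filter_upwards [h] with x hx
  refine lintegral_congr_ae ?_
  filter_upwards [h] with y hy
  rw [hx, hy]

theorem integral_formIntegrand_congr_ae {n : ℕ} {p : ℝ} {K : Rn n → Rn n → ℝ} {u v φ : Rn n → ℝ}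
    (h : u =ᵐ[volume] v) :
    ∫ x, ∫ y, formIntegrand n p K u φ (x, y) = ∫ x, ∫ y, formIntegrand n p K v φ (x, y) := by
  refine integral_congr_ae ?_
  filter_upwards [h] with x hx
  refine integral_congr_ae ?_
  filter_upwards [h] with y hy
  simp only [formIntegrand, hx, hy]

/-- The comparison estimate with an arbitrary upper bound for the datum. -/
theorem exists_const_average_rpow_le {n : ℕ} {s p Λ γ : ℝ} (hn : 0 < n) (hs : 0 < s)
    (hp : 2 ≤ p) (hΛ : 1 ≤ Λ) (hγ1 : 1 ≤ γ)
    (hγ : p < (n : ℝ) / s → γ < (n : ℝ) * (p - 1) / ((n : ℝ) - p * s)) :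
    ∃ C : ℝ, 0 < C ∧ ∀ (K : Rn n → Rn n → ℝ) (μ u v : Rn n → ℝ) (x₀ : Rn n) (r d : ℝ),
      KernelBounds n Λ s p K → Integrable μ → 0 < r → 0 < d →
      WeakSolP n K s p (ball x₀ r) μ u → WeakSolP n K s p (ball x₀ r) (fun _ => 0) v →
      (∀ᵐ x : Rn n, x ∉ ball x₀ r → v x = u x) →
      ∫ x in ball x₀ r, |μ x| ≤ d ^ (p - 1) * r ^ ((n : ℝ) - s * p) →
      ((volume (ball x₀ r))⁻¹ * ∫⁻ x in ball x₀ r, ENNReal.ofReal (|u x - v x| ^ γ)) ^ (1 / γ) ≤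
        ENNReal.ofReal (C * d) := by
  obtain ⟨C, hC, H⟩ := exists_const_lintegral_rpow_le hn hs hp hΛ hγ1 hγ
  have hγ0 : 0 < γ := by linarith
  refine ⟨C ^ (1 / γ), by positivity, fun K μ u v x₀ r d hK hμ hr hd hu hv huv hM => ?_⟩
  obtain ⟨⟨hum, -, hgu⟩, hsu⟩ := hu
  obtain ⟨⟨hvm, -, hgv⟩, hsv⟩ := hv
  rw [Measure.restrict_univ] at hum hvm
  classical
  have hv' : v =ᵐ[volume] (ball x₀ r).piecewise (hvm.mk v) (hum.mk u) := by
    filter_upwards [huv, hum.ae_eq_mk, hvm.ae_eq_mk] with x h1 h2 h3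
    by_cases hx : x ∈ ball x₀ r
    · rw [piecewise_eq_of_mem _ _ _ hx, h3]
    · rw [piecewise_eq_of_notMem _ _ _ hx, h1 hx, h2]
  have hu' := hum.ae_eq_mk
  have hmain := H K μ (hum.mk u) ((ball x₀ r).piecewise (hvm.mk v) (hum.mk u)) x₀ r d hK
    hum.measurable_mk (hvm.measurable_mk.piecewise measurableSet_ball hum.measurable_mk)
    (gagliardo_univ_congr_ae hu' ▸ hgu) (gagliardo_univ_congr_ae hv' ▸ hgv) hμ hr hd
    (fun x hx => piecewise_eq_of_notMem _ _ _ hx)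
    (fun ψ hψ => (integral_formIntegrand_congr_ae hu').symm.trans (hsu ψ hψ))
    (fun ψ hψ => (integral_formIntegrand_congr_ae hv').symm.trans
      ((hsv ψ hψ).trans (by simp))) hM
  have hV0 : volume (ball x₀ r) ≠ 0 := (measure_ball_pos _ _ hr).ne'
  have hVt : volume (ball x₀ r) ≠ ⊤ := measure_ball_lt_top.ne
  have hcongr : ∫⁻ x in ball x₀ r, ENNReal.ofReal (|u x - v x| ^ γ) =
      ∫⁻ x in ball x₀ r, ENNReal.ofReal
        (|hum.mk u x - (ball x₀ r).piecewise (hvm.mk v) (hum.mk u) x| ^ γ) := by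
    refine lintegral_congr_ae (ae_restrict_of_ae ?_)
    filter_upwards [hu', hv'] with x h1 h2
    rw [h1, h2]
  calc _ ≤ ((volume (ball x₀ r))⁻¹ *
        (ENNReal.ofReal (C * d ^ γ) * volume (ball x₀ r))) ^ (1 / γ) := by
        rw [hcongr]; gcongr
    _ = ENNReal.ofReal (C * d ^ γ) ^ (1 / γ) := by
        rw [mul_comm, mul_assoc, ENNReal.mul_inv_cancel hV0 hVt, mul_one]
    _ = _ := by
        rw [ENNReal.ofReal_rpow_of_nonneg (by positivity) (by positivity),
          Real.mul_rpow hC.le (by positivity), ← Real.rpow_mul hd.le, mul_one_div_cancel hγ0.ne',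
          Real.rpow_one]

/-- Lemma 3.3, comparison estimate for solutions, `p ≥ 2`.
The constant `C γ` depends only on `n, s, p, Λ` and `γ* - γ`. -/
theorem comparison_estimate_sol_p_ge_two
    (n : ℕ) (s p Λ : ℝ)
    (hn : 2 ≤ n) (hs : 0 < s) (hs1 : s < 1) (hp2 : 2 ≤ p) (hΛ : 1 ≤ Λ) :
    ∃ C : ℝ → ℝ, (∀ γ : ℝ, 1 ≤ γ → 0 < C γ) ∧
      ∀ γ : ℝ, 1 ≤ γ →
        (p < (n : ℝ) / s → γ < (n : ℝ) * (p - 1) / ((n : ℝ) - p * s)) →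
        ∀ (Kt : Rn n → Rn n → ℝ) (μ u v : Rn n → ℝ) (x₀ : Rn n) (r : ℝ),
          SymKernel n Λ s p Kt →
          ContDiff ℝ (⊤ : ℕ∞) μ → HasCompactSupport μ →
          0 < r →
          WeakSolP n Kt s p (ball x₀ (2 * r)) μ u →
          WeakSolP n Kt s p (ball x₀ r) (fun _ => 0) v →
          (∀ᵐ x : Rn n, x ∉ ball x₀ r → v x = u x) →
          ((volume (ball x₀ r))⁻¹ *
              ∫⁻ x in ball x₀ r,
                ENNReal.ofReal (|u x - v x| ^ γ)) ^ (1 / γ) ≤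
            ENNReal.ofReal (C γ) *
              ENNReal.ofReal
                (((∫ x in ball x₀ r, |μ x|) / r ^ ((n : ℝ) - s * p)) ^ (1 / (p - 1))) := by
  have hn0 : 0 < n := by omega
  have hp1 : 0 < p - 1 := by linarith
  have hex : ∀ γ : ℝ, ∃ C : ℝ, 0 < C ∧ (1 ≤ γ →
      (p < (n : ℝ) / s → γ < (n : ℝ) * (p - 1) / ((n : ℝ) - p * s)) →
      ∀ (K : Rn n → Rn n → ℝ) (μ u v : Rn n → ℝ) (x₀ : Rn n) (r d : ℝ),
        KernelBounds n Λ s p K → Integrable μ → 0 < r → 0 < d →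
        WeakSolP n K s p (ball x₀ r) μ u → WeakSolP n K s p (ball x₀ r) (fun _ => 0) v →
        (∀ᵐ x : Rn n, x ∉ ball x₀ r → v x = u x) →
        ∫ x in ball x₀ r, |μ x| ≤ d ^ (p - 1) * r ^ ((n : ℝ) - s * p) →
        ((volume (ball x₀ r))⁻¹ * ∫⁻ x in ball x₀ r, ENNReal.ofReal (|u x - v x| ^ γ)) ^ (1 / γ) ≤
          ENNReal.ofReal (C * d)) := by
    intro γ
    by_cases h : 1 ≤ γ ∧ (p < (n : ℝ) / s → γ < (n : ℝ) * (p - 1) / ((n : ℝ) - p * s))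
    · obtain ⟨C, hC, H⟩ := exists_const_average_rpow_le hn0 hs hp2 hΛ h.1 h.2
      exact ⟨C, hC, fun _ _ => H⟩
    · exact ⟨1, one_pos, fun h1 h2 => absurd ⟨h1, h2⟩ h⟩
  choose C hC H using hex
  refine ⟨C, fun γ _ => hC γ, fun γ hγ1 hγ Kt μ u v x₀ r hK hμ hμc hr hu hv huv => ?_⟩
  have hμi : Integrable μ := hμ.continuous.integrable_of_hasCompactSupport hμc
  have hM : 0 ≤ ∫ x in ball x₀ r, |μ x| := integral_nonneg fun x => abs_nonneg _
  have hur : WeakSolP n Kt s p (ball x₀ r) μ u :=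
    ⟨hu.1, fun φ hφ => hu.2 φ ⟨hφ.1, hφ.2.1, hφ.2.2.trans (ball_subset_ball (by linarith))⟩⟩
  set D := ((∫ x in ball x₀ r, |μ x|) / r ^ ((n : ℝ) - s * p)) ^ (1 / (p - 1)) with hD
  have hD0 : 0 ≤ D := by positivity
  have hDp : D ^ (p - 1) * r ^ ((n : ℝ) - s * p) = ∫ x in ball x₀ r, |μ x| := by
    rw [hD, ← Real.rpow_mul (by positivity), one_div_mul_cancel hp1.ne', Real.rpow_one,
      div_mul_cancel₀ _ (by positivity)]
  rw [← ENNReal.ofReal_mul (hC γ).le]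
  have hcont : Continuous fun d : ℝ => ENNReal.ofReal (C γ * d) :=
    ENNReal.continuous_ofReal.comp (continuous_const.mul continuous_id)
  refine ge_of_tendsto (x := 𝓝[>] D) (hcont.tendsto D |>.mono_left nhdsWithin_le_nhds) ?_
  filter_upwards [self_mem_nhdsWithin] with d hd
  have hDd : D < d := hd
  refine H γ hγ1 hγ Kt μ u v x₀ r d hK.1 hμi hr (by linarith) hur hv huv ?_
  rw [← hDp]
  gcongr
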